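/- arXiv:math/0602384 — 5 statements merged into one kernel-verified Lean document; each statement's English description precedes it below -/
import Mathlib

section
/- Let 0 < α, γ ≤ 1 with α + γ > 1 and let 0 < ε < α + γ − 1. Then there exists a constant C > 0 (depending only on α, γ, ε) such that for all continuously differentiable functions f, g : [0,1] → ℝ with f(0) = 0 and all t ∈ [0,1], |∫₀ᵗ f(r) g′(r) dr| ≤ C ‖f‖_α ‖g‖_γ t^{1+ε}. -/
open Set

/-- The `β`-Hölder norm on `[0,1]`:
`‖f‖_β = sup_{s ≠ t ∈ [0,1]} |f t - f s| / |t - s|^β + sup_{t ∈ [0,1]} |f t|`. -/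
noncomputable def holderNorm (β : ℝ) (f : ℝ → ℝ) : ℝ :=
  (⨆ p : {p : ℝ × ℝ // p.1 ∈ Set.Icc (0:ℝ) 1 ∧ p.2 ∈ Set.Icc (0:ℝ) 1 ∧ p.1 ≠ p.2},
      |f (p : ℝ × ℝ).1 - f (p : ℝ × ℝ).2| / |(p : ℝ × ℝ).1 - (p : ℝ × ℝ).2| ^ β)
    + ⨆ t : Set.Icc (0:ℝ) 1, |f (t : ℝ)|

lemma lip_aux (f : ℝ → ℝ) (hf : ContDiff ℝ 1 f) :
    ∃ L : ℝ, 0 ≤ L ∧ (∀ x ∈ Set.Icc (0:ℝ) 1, |deriv f x| ≤ L) ∧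
      ∀ x ∈ Set.Icc (0:ℝ) 1, ∀ y ∈ Set.Icc (0:ℝ) 1, |f x - f y| ≤ L * |x - y| := by
  have hc : Continuous (deriv f) := hf.continuous_deriv le_rfl
  obtain ⟨L, hL⟩ := (isCompact_Icc (a := (0:ℝ)) (b := 1)).exists_bound_of_continuousOn
    hc.continuousOn
  have h0 : 0 ≤ L := (norm_nonneg _).trans (hL 0 (by simp))
  refine ⟨L, h0, fun x hx => hL x hx, fun x hx y hy => ?_⟩
  exact (convex_Icc (0:ℝ) 1).norm_image_sub_le_of_norm_deriv_le
    (fun z _ => (hf.differentiable one_ne_zero) z) hL hy hx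

lemma holder_aux (β : ℝ) (hβ : 0 < β) (hβ1 : β ≤ 1) (f : ℝ → ℝ) (hf : ContDiff ℝ 1 f) :
    0 ≤ holderNorm β f ∧ ∀ x ∈ Set.Icc (0:ℝ) 1, ∀ y ∈ Set.Icc (0:ℝ) 1,
      |f x - f y| ≤ holderNorm β f * |x - y| ^ β := by
  obtain ⟨L, hL0, -, hL⟩ := lip_aux f hf
  have h2 : 0 ≤ ⨆ t : Set.Icc (0:ℝ) 1, |f (t : ℝ)| :=
    Real.iSup_nonneg fun _ => abs_nonneg _
  refine ⟨add_nonneg (Real.iSup_nonneg fun _ => by positivity) h2, ?_⟩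
  intro x hx y hy
  by_cases hxy : x = y
  · subst hxy; simp [Real.zero_rpow hβ.ne']
  have hpos : 0 < |x - y| := abs_pos.mpr (sub_ne_zero.mpr hxy)
  rw [← div_le_iff₀ (Real.rpow_pos_of_pos hpos _)]
  have hb : BddAbove (Set.range fun p : {p : ℝ × ℝ // p.1 ∈ Set.Icc (0:ℝ) 1 ∧
      p.2 ∈ Set.Icc (0:ℝ) 1 ∧ p.1 ≠ p.2} =>
      |f (p : ℝ × ℝ).1 - f (p : ℝ × ℝ).2| / |(p : ℝ × ℝ).1 - (p : ℝ × ℝ).2| ^ β) := by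
    refine ⟨L, ?_⟩
    rintro _ ⟨⟨⟨a, b⟩, ha, hb, hab⟩, rfl⟩
    simp only at ha hb hab ⊢
    have hp : 0 < |a - b| := abs_pos.mpr (sub_ne_zero.mpr hab)
    rw [div_le_iff₀ (Real.rpow_pos_of_pos hp _)]
    refine (hL a ha b hb).trans (mul_le_mul_of_nonneg_left ?_ hL0)
    have h1 : |a - b| ≤ 1 := by
      rw [abs_le]; constructor <;> linarith [ha.1, ha.2, hb.1, hb.2]
    exact Real.self_le_rpow_of_le_one hp.le h1 hβ1
  have := le_ciSup hb ⟨(x, y), hx, hy, hxy⟩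
  simp only at this
  unfold holderNorm
  linarith

theorem young_integral_bound
    (α γ : ℝ) (hα : 0 < α) (hα1 : α ≤ 1) (hγ : 0 < γ) (hγ1 : γ ≤ 1)
    (hαγ : 1 < α + γ) (ε : ℝ) (hε : 0 < ε) (hε' : ε < α + γ - 1) :
    ∃ C > 0, ∀ f g : ℝ → ℝ, ContDiff ℝ 1 f → ContDiff ℝ 1 g → f 0 = 0 →
      ∀ t ∈ Set.Icc (0:ℝ) 1,
        |∫ r in (0:ℝ)..t, f r * deriv g r|
          ≤ C * holderNorm α f * holderNorm γ g * t ^ (1 + ε) := by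
  have h2 : (2:ℝ) < 2 ^ (α + γ) := by
    simpa using Real.rpow_lt_rpow_of_exponent_lt (x := 2) (by norm_num) hαγ
  refine ⟨1 / (2 ^ (α + γ) - 2), by apply one_div_pos.mpr; linarith, ?_⟩
  intro f g hf hg hf0 t ht
  set K : ℝ := 1 / (2 ^ (α + γ) - 2) with hK
  have hK0 : 0 < K := by apply one_div_pos.mpr; linarith
  have hKe : 2 * K + 1 = K * 2 ^ (α + γ) := by
    have : (2:ℝ) ^ (α + γ) - 2 ≠ 0 := by linarith
    rw [hK]; field_simp; ring
  obtain ⟨hF0, hF⟩ := holder_aux α hα hα1 f hf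
  obtain ⟨hG0, hG⟩ := holder_aux γ hγ hγ1 g hg
  obtain ⟨Lf, hLf0, -, hLf⟩ := lip_aux f hf
  obtain ⟨Lg, hLg0, hLg, -⟩ := lip_aux g hg
  set F := holderNorm α f
  set G := holderNorm γ g
  have hc : Continuous (deriv g) := hg.continuous_deriv le_rfl
  have hfc : Continuous f := hf.continuous
  have hint : ∀ c a b, IntervalIntegrable (fun r => (f r - c) * deriv g r)
      MeasureTheory.volume a b := fun c a b =>
    ((hfc.sub continuous_const).mul hc).intervalIntegrable a b
  have key : ∀ n : ℕ, ∀ s u : ℝ, 0 ≤ s → s ≤ u → u ≤ 1 →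
      |∫ r in s..u, (f r - f s) * deriv g r| ≤
        K * F * G * (u - s) ^ (α + γ) + (1/2)^n * (Lf * Lg * (u - s)^2) := by
    intro n
    induction n with
    | zero =>
      intro s u hs hsu hu
      have h1 : ‖∫ r in s..u, (f r - f s) * deriv g r‖ ≤ (Lf * (u - s) * Lg) * |u - s| := by
        apply intervalIntegral.norm_integral_le_of_norm_le_const
        intro r hr
        rw [Set.uIoc_of_le hsu] at hr
        have hr' : r ∈ Set.Icc (0:ℝ) 1 := ⟨by linarith [hr.1], by linarith [hr.2]⟩
        rw [norm_mul]
        have e1 := hLf r hr' s ⟨hs, by linarith⟩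
        rw [abs_of_nonneg (show 0 ≤ r - s by linarith [hr.1])] at e1
        have e2 : |f r - f s| ≤ Lf * (u - s) :=
          e1.trans (mul_le_mul_of_nonneg_left (by linarith [hr.2]) hLf0)
        exact mul_le_mul e2 (hLg r hr') (abs_nonneg _)
          (mul_nonneg hLf0 (by linarith))
      rw [abs_of_nonneg (show 0 ≤ u - s by linarith), Real.norm_eq_abs] at h1
      have h3 : 0 ≤ K * F * G * (u - s) ^ (α + γ) :=
        mul_nonneg (by positivity) (Real.rpow_nonneg (by linarith) _)
      have h4 : (1/2:ℝ)^0 * (Lf * Lg * (u - s)^2) = (Lf * (u - s) * Lg) * (u - s) := by ring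
      linarith
    | succ n ih =>
      intro s u hs hsu hu
      obtain ⟨d, hd⟩ : ∃ d, d = (u - s) / 2 := ⟨_, rfl⟩
      have hd0 : 0 ≤ d := by linarith
      obtain ⟨m, hm⟩ : ∃ m, m = s + d := ⟨_, rfl⟩
      have i1 := ih s m hs (by linarith) (by linarith)
      have i2 := ih m u (by linarith) (by linarith) hu
      rw [show m - s = d by linarith] at i1
      rw [show u - m = d by linarith] at i2
      have hdec : ∫ r in s..u, (f r - f s) * deriv g r =
          (∫ r in s..m, (f r - f s) * deriv g r) + (∫ r in m..u, (f r - f m) * deriv g r)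
            + (f m - f s) * (g u - g m) := by
        rw [← intervalIntegral.integral_add_adjacent_intervals (hint (f s) s m) (hint (f s) m u)]
        have e : ∫ r in m..u, deriv g r = g u - g m :=
          intervalIntegral.integral_deriv_eq_sub
            (fun x _ => (hg.differentiable one_ne_zero) x) (hc.intervalIntegrable _ _)
        have e' : ∫ r in m..u, (f r - f s) * deriv g r =
            (∫ r in m..u, (f r - f m) * deriv g r) + ∫ r in m..u, (f m - f s) * deriv g r := by
          have hi : IntervalIntegrable (fun r => (f m - f s) * deriv g r)
              MeasureTheory.volume m u := (continuous_const.mul hc).intervalIntegrable _ _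
          rw [← intervalIntegral.integral_add (hint (f m) m u) hi]
          congr 1; ext r; ring
        rw [e', intervalIntegral.integral_const_mul, e]; ring
      have hm' : m ∈ Set.Icc (0:ℝ) 1 := ⟨by linarith, by linarith⟩
      have hprod : |(f m - f s) * (g u - g m)| ≤ F * G * d ^ (α + γ) := by
        have e1 := hF m hm' s ⟨hs, by linarith⟩
        have e2 := hG u ⟨by linarith, hu⟩ m hm'
        rw [show m - s = d by linarith, abs_of_nonneg hd0] at e1
        rw [show u - m = d by linarith, abs_of_nonneg hd0] at e2
        rw [abs_mul, Real.rpow_add_of_nonneg hd0 hα.le hγ.le]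
        calc _ ≤ (F * d ^ α) * (G * d ^ γ) :=
              mul_le_mul e1 e2 (abs_nonneg _) (by positivity)
          _ = _ := by ring
      have hdd : K * F * G * (u - s) ^ (α + γ) = (2 * K + 1) * F * G * d ^ (α + γ) := by
        rw [show u - s = 2 * d by linarith, Real.mul_rpow (by norm_num) hd0, hKe]; ring
      have hq : (1/2:ℝ)^(n+1) * (Lf * Lg * (u - s)^2) = 2 * ((1/2:ℝ)^n * (Lf * Lg * d^2)) := by
        rw [show u - s = 2 * d by linarith]; ring
      rw [hdec, hdd, hq]
      refine (abs_add_le _ _).trans ?_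
      have := abs_add_le (∫ r in s..m, (f r - f s) * deriv g r)
        (∫ r in m..u, (f r - f m) * deriv g r)
      linarith
  have hlim : |∫ r in (0:ℝ)..t, f r * deriv g r| ≤ K * F * G * t ^ (α + γ) := by
    have hT : Filter.Tendsto (fun n : ℕ => K * F * G * t ^ (α + γ)
        + (1/2:ℝ)^n * (Lf * Lg * t^2)) Filter.atTop (nhds (K * F * G * t ^ (α + γ))) := by
      have := ((tendsto_pow_atTop_nhds_zero_of_lt_one (r := (1/2:ℝ)) (by norm_num)
        (by norm_num)).mul_const (Lf * Lg * t^2)).const_add (K * F * G * t ^ (α + γ))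
      simpa using this
    refine ge_of_tendsto' hT fun n => ?_
    have := key n 0 t le_rfl ht.1 ht.2
    simpa [hf0] using this
  refine hlim.trans (mul_le_mul_of_nonneg_left ?_ (by positivity))
  rcases ht.1.eq_or_lt with h | h
  · rw [← h, Real.zero_rpow (by linarith), Real.zero_rpow (by linarith)]
  · exact Real.rpow_le_rpow_of_exponent_ge h ht.2 (by linarith)
end

section
/- Let 0 < α, γ ≤ 1 with α + γ > 1 and let 0 < ε < α + γ − 1. Then there exists a constant C > 0 (depending only on α, γ, ε) such that for all continuously differentiable functions f, g : [0,1] → ℝ and all s, t ∈ [0,1], |∫ₛᵗ f(r) g′(r) dr − f(s)(g(t) − g(s))| ≤ C ‖f‖_α ‖g‖_γ |t − s|^{1+ε}. In particular, the function t ↦ ∫₀ᵗ f(r) g′(r) dr is γ-Hölder continuous, with γ-Hölder seminorm bounded by (1 + C) ‖f‖_α ‖g‖_γ. -/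
open Set

lemma yi_lip (f : ℝ → ℝ) (hf : ContDiff ℝ 1 f) :
    ∃ L, 0 ≤ L ∧ (∀ x ∈ Set.Icc (0:ℝ) 1, |deriv f x| ≤ L) ∧
      ∀ x ∈ Set.Icc (0:ℝ) 1, ∀ y ∈ Set.Icc (0:ℝ) 1, |f x - f y| ≤ L * |x - y| := by
  obtain ⟨L, hL⟩ := (isCompact_Icc (a := (0:ℝ)) (b := 1)).exists_bound_of_continuousOn
    (hf.continuous_deriv le_rfl).continuousOn
  have h0 : 0 ≤ L := (norm_nonneg _).trans (hL 0 (by simp))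
  refine ⟨L, h0, hL, fun x hx y hy => ?_⟩
  exact Convex.norm_image_sub_le_of_norm_deriv_le (s := Set.Icc (0:ℝ) 1)
    (fun z _ => (hf.differentiable one_ne_zero) z) hL (convex_Icc 0 1) hy hx

lemma yi_dist {x y : ℝ} (hx : x ∈ Set.Icc (0:ℝ) 1) (hy : y ∈ Set.Icc (0:ℝ) 1) : |x - y| ≤ 1 := by
  rw [abs_le]; constructor <;> linarith [hx.1, hx.2, hy.1, hy.2]

lemma yi_norm (β : ℝ) (hβ : 0 < β) (hβ1 : β ≤ 1) (f : ℝ → ℝ) (hf : ContDiff ℝ 1 f) :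
    0 ≤ holderNorm β f ∧ (∀ x ∈ Set.Icc (0:ℝ) 1, |f x| ≤ holderNorm β f) ∧
      ∀ x ∈ Set.Icc (0:ℝ) 1, ∀ y ∈ Set.Icc (0:ℝ) 1,
        |f x - f y| ≤ holderNorm β f * |x - y| ^ β := by
  obtain ⟨L, hL0, -, hL⟩ := yi_lip f hf
  have b1 : BddAbove (Set.range fun p : {p : ℝ × ℝ // p.1 ∈ Set.Icc (0:ℝ) 1 ∧
      p.2 ∈ Set.Icc (0:ℝ) 1 ∧ p.1 ≠ p.2} =>
      |f (p : ℝ × ℝ).1 - f (p : ℝ × ℝ).2| / |(p : ℝ × ℝ).1 - (p : ℝ × ℝ).2| ^ β) := by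
    refine ⟨L, ?_⟩
    rintro _ ⟨⟨⟨x, y⟩, hx, hy, hne⟩, rfl⟩
    have hp : 0 < |x - y| := abs_pos.2 (sub_ne_zero.2 hne)
    show |f x - f y| / |x - y| ^ β ≤ L
    rw [div_le_iff₀ (Real.rpow_pos_of_pos hp β)]
    refine (hL x hx y hy).trans (mul_le_mul_of_nonneg_left ?_ hL0)
    exact Real.self_le_rpow_of_le_one hp.le (yi_dist hx hy) hβ1
  have b2 : BddAbove (Set.range fun t : Set.Icc (0:ℝ) 1 => |f (t : ℝ)|) := by
    obtain ⟨M, hM⟩ := (isCompact_Icc (a := (0:ℝ)) (b := 1)).exists_bound_of_continuousOn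
      hf.continuous.continuousOn
    refine ⟨M, ?_⟩
    rintro _ ⟨⟨x, hx⟩, rfl⟩
    exact hM x hx
  have n1 : 0 ≤ (⨆ p : {p : ℝ × ℝ // p.1 ∈ Set.Icc (0:ℝ) 1 ∧ p.2 ∈ Set.Icc (0:ℝ) 1 ∧ p.1 ≠ p.2},
      |f (p : ℝ × ℝ).1 - f (p : ℝ × ℝ).2| / |(p : ℝ × ℝ).1 - (p : ℝ × ℝ).2| ^ β) :=
    Real.iSup_nonneg fun p => by positivity
  have n2 : 0 ≤ ⨆ t : Set.Icc (0:ℝ) 1, |f (t : ℝ)| := Real.iSup_nonneg fun p => abs_nonneg _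
  refine ⟨add_nonneg n1 n2, fun x hx => ?_, fun x hx y hy => ?_⟩
  · have := le_ciSup b2 ⟨x, hx⟩
    simp only at this
    unfold holderNorm
    linarith
  · by_cases hne : x = y
    · subst hne; simp [hβ.ne']
    · have hp : 0 < |x - y| := abs_pos.2 (sub_ne_zero.2 hne)
      have := le_ciSup b1 ⟨(x, y), hx, hy, hne⟩
      rw [← div_le_iff₀ (Real.rpow_pos_of_pos hp β)]
      simp only at this
      unfold holderNorm
      linarith

lemma yi_main (α γ : ℝ) (hα : 0 < α) (hα1 : α ≤ 1) (hγ : 0 < γ) (hγ1 : γ ≤ 1)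
    (hαγ : 1 < α + γ) (f g : ℝ → ℝ) (hf : ContDiff ℝ 1 f) (hg : ContDiff ℝ 1 g)
    (C : ℝ) (hC : 2 * C + 1 = C * 2 ^ (α + γ)) :
    ∀ s ∈ Set.Icc (0:ℝ) 1, ∀ t ∈ Set.Icc (0:ℝ) 1,
      |(∫ r in s..t, f r * deriv g r) - f s * (g t - g s)|
        ≤ C * holderNorm α f * holderNorm γ g * |t - s| ^ (α + γ) := by
  obtain ⟨A0, -, hA⟩ := yi_norm α hα hα1 f hf
  obtain ⟨B0, -, hB⟩ := yi_norm γ hγ hγ1 g hg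
  set A := holderNorm α f
  set B := holderNorm γ g
  obtain ⟨L, hL0, -, hL⟩ := yi_lip f hf
  obtain ⟨M, hM0, hM, -⟩ := yi_lip g hg
  have cg : Continuous (deriv g) := hg.continuous_deriv le_rfl
  have hint : ∀ a b, IntervalIntegrable (fun r => f r * deriv g r) MeasureTheory.volume a b :=
    fun a b => (hf.continuous.mul cg).intervalIntegrable a b
  have ftc : ∀ a b, ∫ r in a..b, deriv g r = g b - g a := fun a b =>
    intervalIntegral.integral_deriv_eq_sub
      (fun x _ => (hg.differentiable one_ne_zero) x) (cg.intervalIntegrable a b)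
  have hC0 : 0 ≤ C := by
    have h2 : (2:ℝ) < 2 ^ (α + γ) := by
      simpa using Real.rpow_lt_rpow_of_exponent_lt (x := 2) one_lt_two hαγ
    by_contra h
    push Not at h
    nlinarith
  have key : ∀ n : ℕ, ∀ s ∈ Set.Icc (0:ℝ) 1, ∀ t ∈ Set.Icc (0:ℝ) 1,
      |(∫ r in s..t, f r * deriv g r) - f s * (g t - g s)|
        ≤ C * A * B * |t - s| ^ (α + γ) + L * M * (1/2) ^ n * |t - s| ^ 2 := by
    intro n
    induction n with
    | zero =>
      intro s hs t ht
      have e : (∫ r in s..t, f r * deriv g r) - f s * (g t - g s)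
          = ∫ r in s..t, (f r - f s) * deriv g r := by
        rw [← ftc, ← intervalIntegral.integral_const_mul, ← intervalIntegral.integral_sub (hint s t)
          (((cg.intervalIntegrable s t).const_mul (f s)))]
        congr 1; ext r; ring
      have hb : |∫ r in s..t, (f r - f s) * deriv g r| ≤ (L * |t - s| * M) * |t - s| := by
        rw [← Real.norm_eq_abs (∫ r in s..t, (f r - f s) * deriv g r)]
        refine intervalIntegral.norm_integral_le_of_norm_le_const fun r hr => ?_
        have hr' : r ∈ Set.uIcc s t := Set.uIoc_subset_uIcc hr
        have hr1 : r ∈ Set.Icc (0:ℝ) 1 := Set.uIcc_subset_Icc hs ht hr'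
        have hd : |r - s| ≤ |t - s| := Set.abs_sub_left_of_mem_uIcc hr'
        rw [norm_mul]
        refine mul_le_mul ((hL r hr1 s hs).trans ?_) (hM r hr1) (norm_nonneg _) (by positivity)
        gcongr
      rw [e]
      have : 0 ≤ C * A * B * |t - s| ^ (α + γ) := by positivity
      nlinarith
    | succ n ih =>
      intro s hs t ht
      obtain ⟨m, hm⟩ : ∃ m, m = (s + t) / 2 := ⟨_, rfl⟩
      have hmI : m ∈ Set.Icc (0:ℝ) 1 := by
        constructor <;> linarith [hs.1, hs.2, ht.1, ht.2]
      have d1 : |m - s| = |t - s| / 2 := by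
        rw [show m - s = (t - s) / 2 by rw [hm]; ring, abs_div, abs_two]
      have d2 : |t - m| = |t - s| / 2 := by
        rw [show t - m = (t - s) / 2 by rw [hm]; ring, abs_div, abs_two]
      have i1 := ih s hs m hmI
      have i2 := ih m hmI t ht
      have j1 := hA m hmI s hs
      have j2 := hB t ht m hmI
      rw [d1] at i1 j1
      rw [d2] at i2 j2
      have e : (∫ r in s..t, f r * deriv g r) - f s * (g t - g s)
          = ((∫ r in s..m, f r * deriv g r) - f s * (g m - g s))
            + ((∫ r in m..t, f r * deriv g r) - f m * (g t - g m))
            + (f m - f s) * (g t - g m) := by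
        rw [← intervalIntegral.integral_add_adjacent_intervals (hint s m) (hint m t)]; ring
      obtain ⟨h, hh⟩ : ∃ h, h = |t - s| := ⟨_, rfl⟩
      have h0 : 0 ≤ h := hh ▸ abs_nonneg _
      rw [e, ← hh]
      rw [← hh] at i1 i2 j1 j2
      have j3 : |(f m - f s) * (g t - g m)| ≤ A * B * (h / 2) ^ (α + γ) := by
        rw [abs_mul, Real.rpow_add_of_nonneg (by positivity) hα.le hγ.le]
        calc _ ≤ (A * (h/2) ^ α) * (B * (h/2) ^ γ) :=
              mul_le_mul j1 j2 (abs_nonneg _) (by positivity)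
          _ = _ := by ring
      have hp : h ^ (α + γ) = 2 ^ (α + γ) * (h / 2) ^ (α + γ) := by
        rw [← Real.mul_rpow (by norm_num) (by positivity)]; congr 1; ring
      have k : C * A * B * h ^ (α + γ) = (2 * C + 1) * A * B * (h / 2) ^ (α + γ) := by
        rw [hp, hC]; ring
      have k2 : L * M * (1/2) ^ (n+1) * h ^ 2 = 2 * (L * M * (1/2) ^ n * (h/2) ^ 2) := by ring
      rw [k, k2]
      refine (abs_add_three _ _ _).trans ?_
      linarith
  intro s hs t ht
  have lim : Filter.Tendsto (fun n : ℕ => C * A * B * |t - s| ^ (α + γ)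
      + L * M * (1/2) ^ n * |t - s| ^ 2) Filter.atTop
      (nhds (C * A * B * |t - s| ^ (α + γ) + L * M * 0 * |t - s| ^ 2)) :=
    (((tendsto_pow_atTop_nhds_zero_of_lt_one (by norm_num) (by norm_num)).const_mul _).mul_const
      _).const_add _
  have := ge_of_tendsto' lim fun n => key n s hs t ht
  simpa using this

/-- If `α + γ > 1` and `0 < ε < α + γ - 1`, there is a constant `C > 0` such that for all
`C¹` functions `f, g` and all `s, t ∈ [0,1]`,
`|∫ₛᵗ f g' - f(s)(g(t) - g(s))| ≤ C ‖f‖_α ‖g‖_γ |t-s|^{1+ε}`;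
in particular `t ↦ ∫₀ᵗ f g'` is `γ`-Hölder with seminorm at most `(1+C) ‖f‖_α ‖g‖_γ`. -/
theorem young_integral_increment_bound
    (α γ : ℝ) (hα : 0 < α) (hα1 : α ≤ 1) (hγ : 0 < γ) (hγ1 : γ ≤ 1)
    (hαγ : 1 < α + γ) (ε : ℝ) (hε : 0 < ε) (hε' : ε < α + γ - 1) :
    ∃ C > 0,
      (∀ f g : ℝ → ℝ, ContDiff ℝ 1 f → ContDiff ℝ 1 g →
        ∀ s ∈ Set.Icc (0:ℝ) 1, ∀ t ∈ Set.Icc (0:ℝ) 1,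
          |(∫ r in s..t, f r * deriv g r) - f s * (g t - g s)|
            ≤ C * holderNorm α f * holderNorm γ g * |t - s| ^ (1 + ε)) ∧
      (∀ f g : ℝ → ℝ, ContDiff ℝ 1 f → ContDiff ℝ 1 g →
        ∀ s ∈ Set.Icc (0:ℝ) 1, ∀ t ∈ Set.Icc (0:ℝ) 1,
          |(∫ r in (0:ℝ)..t, f r * deriv g r) - ∫ r in (0:ℝ)..s, f r * deriv g r|
            ≤ (1 + C) * holderNorm α f * holderNorm γ g * |t - s| ^ γ) := by
  have h2 : (2:ℝ) < 2 ^ (α + γ) := by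
    simpa using Real.rpow_lt_rpow_of_exponent_lt (x := 2) one_lt_two hαγ
  have hd : (0:ℝ) < 2 ^ (α + γ) - 2 := by linarith
  have hC : 2 * (1 / ((2:ℝ) ^ (α + γ) - 2)) + 1 = 1 / ((2:ℝ) ^ (α + γ) - 2) * 2 ^ (α + γ) := by
    field_simp; ring
  have hC0 : 0 < 1 / ((2:ℝ) ^ (α + γ) - 2) := by positivity
  generalize 1 / ((2:ℝ) ^ (α + γ) - 2) = C at hC hC0
  have first : ∀ f g : ℝ → ℝ, ContDiff ℝ 1 f → ContDiff ℝ 1 g →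
      ∀ δ, 0 < δ → δ ≤ α + γ → ∀ s ∈ Set.Icc (0:ℝ) 1, ∀ t ∈ Set.Icc (0:ℝ) 1,
        |(∫ r in s..t, f r * deriv g r) - f s * (g t - g s)|
          ≤ C * holderNorm α f * holderNorm γ g * |t - s| ^ δ := by
    intro f g hf hg δ hδ hδ' s hs t ht
    obtain ⟨A0, -, -⟩ := yi_norm α hα hα1 f hf
    obtain ⟨B0, -, -⟩ := yi_norm γ hγ hγ1 g hg
    refine (yi_main α γ hα hα1 hγ hγ1 hαγ f g hf hg C hC s hs t ht).trans ?_
    refine mul_le_mul_of_nonneg_left ?_ (by positivity)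
    exact Real.rpow_le_rpow_of_exponent_ge_of_imp (abs_nonneg _) (yi_dist ht hs) hδ'
      (fun _ h => by linarith)
  refine ⟨C, hC0, fun f g hf hg => first f g hf hg (1 + ε) (by linarith) (by linarith), ?_⟩
  intro f g hf hg s hs t ht
  have hi : ∀ a b, IntervalIntegrable (fun r => f r * deriv g r) MeasureTheory.volume a b :=
    fun a b => (hf.continuous.mul (hg.continuous_deriv le_rfl)).intervalIntegrable a b
  rw [intervalIntegral.integral_interval_sub_left (hi _ _) (hi _ _)]
  have h1 := first f g hf hg γ hγ (by linarith) s hs t ht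
  obtain ⟨A0, hA, -⟩ := yi_norm α hα hα1 f hf
  obtain ⟨B0, -, hB⟩ := yi_norm γ hγ hγ1 g hg
  have h3 : |f s * (g t - g s)| ≤ holderNorm α f * (holderNorm γ g * |t - s| ^ γ) := by
    rw [abs_mul]
    exact mul_le_mul (hA s hs) (hB t ht s hs) (abs_nonneg _) A0
  have h4 := abs_add_le ((∫ r in s..t, f r * deriv g r) - f s * (g t - g s)) (f s * (g t - g s))
  rw [sub_add_cancel] at h4
  linarith
end

section
/- Let 0 < α, γ ≤ 1 with α + γ > 1, and let F(f,g) denote the function t ↦ ∫₀ᵗ f(r) g′(r) dr for continuously differentiable f, g : [0,1] → ℝ. Then there exists a constant C > 0 (depending only on α, γ) such that for all continuously differentiable f, g, h, k : [0,1] → ℝ, ‖F(f,g) − F(h,k)‖_γ ≤ C max(‖g‖_γ, ‖h‖_α) (‖f − h‖_α + ‖g − k‖_γ). -/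
open Set

/-- `F(f,g)(t) = ∫₀ᵗ f(r) g'(r) dr`. -/
noncomputable def youngMap (f g : ℝ → ℝ) : ℝ → ℝ :=
  fun t => ∫ r in (0:ℝ)..t, f r * deriv g r

lemma hn_lip (f : ℝ → ℝ) (hf : ContDiff ℝ 1 f) :
    ∃ L : ℝ, 0 ≤ L ∧ ∀ u ∈ Icc (0:ℝ) 1, ∀ v ∈ Icc (0:ℝ) 1, |f u - f v| ≤ L * |u - v| := by
  obtain ⟨L, hL⟩ := isCompact_Icc.exists_bound_of_continuousOn (s := Icc (0:ℝ) 1)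
    (hf.continuous_deriv le_rfl).continuousOn
  refine ⟨L, (norm_nonneg _).trans (hL 0 (by simp)), fun u hu v hv => ?_⟩
  have := (convex_Icc (0:ℝ) 1).norm_image_sub_le_of_norm_deriv_le (f := f) (C := L)
    (fun x _ => (hf.differentiable one_ne_zero) x) hL hv hu
  simpa [Real.norm_eq_abs] using this

lemma hn_abs_le_one {u v : ℝ} (hu : u ∈ Icc (0:ℝ) 1) (hv : v ∈ Icc (0:ℝ) 1) : |u - v| ≤ 1 := by
  rw [abs_le]; constructor <;> linarith [hu.1, hu.2, hv.1, hv.2]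

lemma hn_bounds (β : ℝ) (hβ1 : β ≤ 1) (f : ℝ → ℝ) (hf : ContDiff ℝ 1 f) :
    0 ≤ holderNorm β f ∧ (∀ u ∈ Icc (0:ℝ) 1, |f u| ≤ holderNorm β f) ∧
    (∀ u ∈ Icc (0:ℝ) 1, ∀ v ∈ Icc (0:ℝ) 1, u ≠ v →
      |f u - f v| ≤ holderNorm β f * |u - v| ^ β) := by
  obtain ⟨L, hL0, hL⟩ := hn_lip f hf
  obtain ⟨M, hM⟩ := isCompact_Icc.exists_bound_of_continuousOn (s := Icc (0:ℝ) 1)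
    hf.continuous.continuousOn
  have b1 : BddAbove (range fun p : {p : ℝ × ℝ // p.1 ∈ Set.Icc (0:ℝ) 1 ∧ p.2 ∈ Set.Icc (0:ℝ) 1 ∧ p.1 ≠ p.2} =>
      |f (p : ℝ × ℝ).1 - f (p : ℝ × ℝ).2| / |(p : ℝ × ℝ).1 - (p : ℝ × ℝ).2| ^ β) := by
    refine ⟨L, ?_⟩
    rintro _ ⟨⟨⟨u, v⟩, hu, hv, huv⟩, rfl⟩
    simp only at hu hv huv ⊢
    have hp : 0 < |u - v| := abs_pos.2 (sub_ne_zero.2 huv)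
    rw [div_le_iff₀ (Real.rpow_pos_of_pos hp _)]
    refine (hL u hu v hv).trans (mul_le_mul_of_nonneg_left ?_ hL0)
    simpa using Real.rpow_le_rpow_of_exponent_ge hp (hn_abs_le_one hu hv) hβ1
  have b2 : BddAbove (range fun t : Set.Icc (0:ℝ) 1 => |f (t : ℝ)|) := by
    refine ⟨M, ?_⟩
    rintro _ ⟨t, rfl⟩
    exact hM t t.2
  have n1 : 0 ≤ ⨆ p : {p : ℝ × ℝ // p.1 ∈ Set.Icc (0:ℝ) 1 ∧ p.2 ∈ Set.Icc (0:ℝ) 1 ∧ p.1 ≠ p.2},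
      |f (p : ℝ × ℝ).1 - f (p : ℝ × ℝ).2| / |(p : ℝ × ℝ).1 - (p : ℝ × ℝ).2| ^ β :=
    Real.iSup_nonneg fun p => by positivity
  have n2 : 0 ≤ ⨆ t : Set.Icc (0:ℝ) 1, |f (t : ℝ)| := Real.iSup_nonneg fun p => by positivity
  refine ⟨add_nonneg n1 n2, fun u hu => ?_, fun u hu v hv huv => ?_⟩
  · have := le_ciSup b2 ⟨u, hu⟩
    simp only at this
    unfold holderNorm
    linarith
  · have := le_ciSup b1 ⟨(u, v), hu, hv, huv⟩
    simp only at this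
    have hp : 0 < |u - v| := abs_pos.2 (sub_ne_zero.2 huv)
    rw [← div_le_iff₀ (Real.rpow_pos_of_pos hp _)]
    unfold holderNorm
    linarith

lemma hn_le (β : ℝ) (f : ℝ → ℝ) (C : ℝ) (hC : 0 ≤ C) (h1 : ∀ u ∈ Icc (0:ℝ) 1, |f u| ≤ C)
    (h2 : ∀ u ∈ Icc (0:ℝ) 1, ∀ v ∈ Icc (0:ℝ) 1, u < v → |f v - f u| ≤ C * |v - u| ^ β) :
    holderNorm β f ≤ 2 * C := by
  unfold holderNorm
  rw [two_mul]
  refine add_le_add (Real.iSup_le ?_ hC) (Real.iSup_le (fun t => h1 t t.2) hC)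
  rintro ⟨⟨u, v⟩, hu, hv, huv⟩
  simp only at hu hv huv ⊢
  have hp : 0 < |u - v| := abs_pos.2 (sub_ne_zero.2 huv)
  rw [div_le_iff₀ (Real.rpow_pos_of_pos hp _)]
  rcases lt_or_gt_of_ne huv with h | h
  · rw [abs_sub_comm, abs_sub_comm u v]; exact h2 u hu v hv h
  · exact h2 v hv u hu h

lemma young_E (α γ : ℝ) (hαγ : 1 < α + γ) (f g : ℝ → ℝ) (hf : ContDiff ℝ 1 f)
    (hg : ContDiff ℝ 1 g) (A B : ℝ) (hA : 0 ≤ A) (hB : 0 ≤ B)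
    (hfA : ∀ u ∈ Icc (0:ℝ) 1, ∀ v ∈ Icc (0:ℝ) 1, u ≠ v → |f u - f v| ≤ A * |u - v| ^ α)
    (hgB : ∀ u ∈ Icc (0:ℝ) 1, ∀ v ∈ Icc (0:ℝ) 1, u ≠ v → |g u - g v| ≤ B * |u - v| ^ γ)
    (s t : ℝ) (hs : s ∈ Icc (0:ℝ) 1) (ht : t ∈ Icc (0:ℝ) 1) (hst : s < t) :
    |∫ r in s..t, (f r - f s) * deriv g r| ≤
      A * B * (1 / (2 ^ (α + γ) - 2)) * (t - s) ^ (α + γ) := by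
  have hgc := hg.continuous_deriv le_rfl
  have hfc := hf.continuous
  obtain ⟨L, hL0, hL⟩ := hn_lip f hf
  obtain ⟨M, hM⟩ := isCompact_Icc.exists_bound_of_continuousOn (s := Icc (0:ℝ) 1)
    hgc.continuousOn
  have hM0 : 0 ≤ M := (norm_nonneg _).trans (hM 0 (by simp))
  set θ := α + γ with hθ
  have h2 : (2:ℝ) < 2 ^ θ := by
    simpa using Real.rpow_lt_rpow_of_exponent_lt (x := 2) (by norm_num) hαγ
  set S := 1 / ((2:ℝ) ^ θ - 2) with hS
  have hS' : (2 * S + 1) = S * 2 ^ θ := by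
    rw [hS]; have : (2:ℝ) ^ θ - 2 ≠ 0 := by linarith
    field_simp; ring
  have key : ∀ n : ℕ, ∀ s ∈ Icc (0:ℝ) 1, ∀ t ∈ Icc (0:ℝ) 1, s < t →
      |∫ r in s..t, (f r - f s) * deriv g r| ≤
        A * B * S * (t - s) ^ θ + L * M * (t - s) ^ 2 * (1 / 2) ^ n := by
    intro n
    induction n with
    | zero =>
      intro s hs t ht hst
      have h0 : 0 ≤ A * B * S * (t - s) ^ θ := by
        have : 0 ≤ (t - s) ^ θ := Real.rpow_nonneg (by linarith) _
        have : 0 ≤ S := by rw [hS]; apply div_nonneg <;> linarith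
        positivity
      have : ‖∫ r in s..t, (f r - f s) * deriv g r‖ ≤ (L * (t - s) * M) * |t - s| := by
        apply intervalIntegral.norm_integral_le_of_norm_le_const
        intro r hr
        rw [uIoc_of_le hst.le] at hr
        have hr' : r ∈ Icc (0:ℝ) 1 := ⟨by linarith [hs.1, hr.1], by linarith [ht.2, hr.2]⟩
        rw [norm_mul]
        refine mul_le_mul ?_ (hM r hr') (norm_nonneg _) (mul_nonneg hL0 (by linarith))
        refine (hL r hr' s hs).trans (mul_le_mul_of_nonneg_left ?_ hL0)
        rw [abs_of_pos (by linarith [hr.1])]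
        linarith [hr.2]
      rw [abs_of_pos (sub_pos.2 hst), Real.norm_eq_abs] at this
      rw [pow_zero]
      nlinarith
    | succ n ih =>
      intro s hs t ht hst
      obtain ⟨d, hd⟩ : ∃ d, d = (t - s) / 2 := ⟨_, rfl⟩
      have hd0 : 0 < d := by linarith
      obtain ⟨u, hu⟩ : ∃ u, u = s + d := ⟨_, rfl⟩
      have hu' : u ∈ Icc (0:ℝ) 1 := ⟨by linarith [hs.1], by linarith [ht.2]⟩
      have i1 := ih s hs u hu' (by linarith)
      have i2 := ih u hu' t ht (by linarith)
      have e1 : u - s = d := by linarith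
      have e2 : t - u = d := by linarith
      have j1 := hfA u hu' s hs (by linarith [e1] : s < u).ne'
      have j2 := hgB t ht u hu' (by linarith [e2] : u < t).ne'
      rw [e1] at i1 j1
      rw [e2] at i2 j2
      rw [abs_of_pos hd0] at j1 j2
      have hint : ∀ c a b : ℝ, IntervalIntegrable (fun r => (f r - c) * deriv g r)
          MeasureTheory.volume a b := fun c a b =>
        Continuous.intervalIntegrable (by fun_prop) a b
      have split : ∫ r in s..t, (f r - f s) * deriv g r =
          (∫ r in s..u, (f r - f s) * deriv g r) + (∫ r in u..t, (f r - f u) * deriv g r)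
            + (f u - f s) * (g t - g u) := by
        rw [← intervalIntegral.integral_add_adjacent_intervals (hint _ s u) (hint _ u t), add_assoc]
        congr 1
        have : g t - g u = ∫ r in u..t, deriv g r :=
          (intervalIntegral.integral_deriv_eq_sub
            (fun x _ => (hg.differentiable one_ne_zero) x) (hgc.intervalIntegrable _ _)).symm
        rw [this, ← intervalIntegral.integral_const_mul, ← intervalIntegral.integral_add (hint _ _ _)
          (Continuous.intervalIntegrable (by fun_prop) _ _)]
        congr 1; ext r; ring
      have j3 : |(f u - f s) * (g t - g u)| ≤ A * B * d ^ θ := by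
        rw [abs_mul, hθ, Real.rpow_add hd0]
        calc _ ≤ (A * d ^ α) * (B * d ^ γ) := mul_le_mul j1 j2 (abs_nonneg _) (by positivity)
          _ = _ := by ring
      have e3 : (t - s) ^ θ = 2 ^ θ * d ^ θ := by
        rw [← Real.mul_rpow (by norm_num) hd0.le]; congr 1; linarith
      have e4 : t - s = 2 * d := by linarith
      rw [split]
      refine (abs_add_le _ _).trans ((add_le_add (abs_add_le _ _) le_rfl).trans
        ((add_le_add (add_le_add i1 i2) j3).trans (le_of_eq ?_)))
      rw [e3, e4, pow_succ]
      linear_combination (A * B * d ^ θ) * hS'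
  have lim : Filter.Tendsto (fun n : ℕ => A * B * S * (t - s) ^ θ + L * M * (t - s) ^ 2 * (1 / 2 : ℝ) ^ n)
      Filter.atTop (nhds (A * B * S * (t - s) ^ θ + L * M * (t - s) ^ 2 * 0)) :=
    ((tendsto_pow_atTop_nhds_zero_of_lt_one (by norm_num) (by norm_num)).const_mul _).const_add _
  have := ge_of_tendsto' lim (fun n => key n s hs t ht hst)
  simpa using this

lemma young_bound (α γ : ℝ) (hα : 0 < α) (hα1 : α ≤ 1) (hγ1 : γ ≤ 1)
    (hαγ : 1 < α + γ) (f g : ℝ → ℝ) (hf : ContDiff ℝ 1 f) (hg : ContDiff ℝ 1 g)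
    (s t : ℝ) (hs : s ∈ Icc (0:ℝ) 1) (ht : t ∈ Icc (0:ℝ) 1) (hst : s < t) :
    |∫ r in s..t, f r * deriv g r| ≤
      (1 + 1 / (2 ^ (α + γ) - 2)) * (holderNorm α f * holderNorm γ g) * (t - s) ^ γ := by
  obtain ⟨f0, f1, f2⟩ := hn_bounds α hα1 f hf
  obtain ⟨g0, g1, g2⟩ := hn_bounds γ hγ1 g hg
  have hgc := hg.continuous_deriv le_rfl
  have hfc := hf.continuous
  have h2 : (2:ℝ) < 2 ^ (α + γ) := by
    simpa using Real.rpow_lt_rpow_of_exponent_lt (x := 2) (by norm_num) hαγ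
  have hS : 0 ≤ 1 / ((2:ℝ) ^ (α + γ) - 2) := by apply div_nonneg <;> linarith
  have E := young_E α γ hαγ f g hf hg _ _ f0 g0 f2 g2 s t hs ht hst
  have hd : 0 < t - s := sub_pos.2 hst
  have hp : (t - s) ^ (α + γ) ≤ (t - s) ^ γ :=
    Real.rpow_le_rpow_of_exponent_ge hd (by linarith [hs.1, ht.2]) (by linarith)
  have split : ∫ r in s..t, f r * deriv g r =
      f s * (g t - g s) + ∫ r in s..t, (f r - f s) * deriv g r := by
    have : g t - g s = ∫ r in s..t, deriv g r :=
      (intervalIntegral.integral_deriv_eq_sub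
        (fun x _ => (hg.differentiable one_ne_zero) x) (hgc.intervalIntegrable _ _)).symm
    rw [this, ← intervalIntegral.integral_const_mul, ← intervalIntegral.integral_add
      (Continuous.intervalIntegrable (by fun_prop) _ _)
      (Continuous.intervalIntegrable (by fun_prop) _ _)]
    congr 1; ext r; ring
  have j := g2 t ht s hs hst.ne'
  rw [abs_of_pos hd] at j
  have j3 : |f s * (g t - g s)| ≤ holderNorm α f * (holderNorm γ g * (t - s) ^ γ) := by
    rw [abs_mul]; exact mul_le_mul (f1 s hs) j (abs_nonneg _) f0
  have := mul_le_mul_of_nonneg_left hp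
    (mul_nonneg (mul_nonneg f0 g0) hS)
  rw [split]
  refine (abs_add_le _ _).trans ((add_le_add j3 (E.trans this)).trans (le_of_eq ?_))
  ring

/-- If `α + γ > 1`, there is `C > 0` such that for all `C¹` functions `f, g, h, k`,
`‖F(f,g) - F(h,k)‖_γ ≤ C max(‖g‖_γ, ‖h‖_α) (‖f - h‖_α + ‖g - k‖_γ)`. -/
theorem young_map_lipschitz
    (α γ : ℝ) (hα : 0 < α) (hα1 : α ≤ 1) (hγ : 0 < γ) (hγ1 : γ ≤ 1)
    (hαγ : 1 < α + γ) :
    ∃ C > 0, ∀ f g h k : ℝ → ℝ,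
      ContDiff ℝ 1 f → ContDiff ℝ 1 g → ContDiff ℝ 1 h → ContDiff ℝ 1 k →
        holderNorm γ (fun t => youngMap f g t - youngMap h k t)
          ≤ C * max (holderNorm γ g) (holderNorm α h) *
              (holderNorm α (fun t => f t - h t) + holderNorm γ (fun t => g t - k t)) := by
  have h2 : (2:ℝ) < 2 ^ (α + γ) := by
    simpa using Real.rpow_lt_rpow_of_exponent_lt (x := 2) (by norm_num) hαγ
  have hS : 0 ≤ 1 / ((2:ℝ) ^ (α + γ) - 2) := by apply div_nonneg <;> linarith
  refine ⟨2 * (1 + 1 / (2 ^ (α + γ) - 2)), by linarith, fun f g h k hf hg hh hk => ?_⟩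
  have hfh : ContDiff ℝ 1 (fun t => f t - h t) := hf.sub hh
  have hgk : ContDiff ℝ 1 (fun t => g t - k t) := hg.sub hk
  have n1 := (hn_bounds α hα1 _ hfh).1
  have n2 := (hn_bounds γ hγ1 _ hgk).1
  have n3 := (hn_bounds γ hγ1 _ hg).1
  have n4 := (hn_bounds α hα1 _ hh).1
  have B1 := young_bound α γ hα hα1 hγ1 hαγ _ g hfh hg
  have B2 := young_bound α γ hα hα1 hγ1 hαγ h _ hh hgk
  set K := 1 + 1 / ((2:ℝ) ^ (α + γ) - 2)
  set m := max (holderNorm γ g) (holderNorm α h)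
  have m1 : holderNorm γ g ≤ m := le_max_left _ _
  have m2 : holderNorm α h ≤ m := le_max_right _ _
  set a := holderNorm α (fun t => f t - h t)
  set b := holderNorm γ (fun t => g t - k t)
  have hK : 0 ≤ K := by positivity
  have hm : 0 ≤ m := n3.trans m1
  have hfc := hf.continuous
  have hhc := hh.continuous
  have hgc := hg.continuous_deriv le_rfl
  have hkc := hk.continuous_deriv le_rfl
  have main : ∀ s ∈ Icc (0:ℝ) 1, ∀ t ∈ Icc (0:ℝ) 1, s < t →
      |(youngMap f g t - youngMap h k t) - (youngMap f g s - youngMap h k s)|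
        ≤ K * m * (a + b) * (t - s) ^ γ := by
    intro s hs t ht hst
    have hp : 0 ≤ (t - s) ^ γ := Real.rpow_nonneg (by linarith) _
    have e : (youngMap f g t - youngMap h k t) - (youngMap f g s - youngMap h k s) =
        (∫ r in s..t, (f r - h r) * deriv g r) +
          ∫ r in s..t, h r * deriv (fun t => g t - k t) r := by
      have hd : ∀ r, deriv (fun t => g t - k t) r = deriv g r - deriv k r := fun r =>
        deriv_fun_sub (hg.differentiable one_ne_zero r) (hk.differentiable one_ne_zero r)
      simp only [hd]
      have i1 : ∀ a b, IntervalIntegrable (fun r => f r * deriv g r) MeasureTheory.volume a b :=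
        fun a b => Continuous.intervalIntegrable (by fun_prop) a b
      have i2 : ∀ a b, IntervalIntegrable (fun r => h r * deriv k r) MeasureTheory.volume a b :=
        fun a b => Continuous.intervalIntegrable (by fun_prop) a b
      have e1 : youngMap f g t - youngMap f g s = ∫ r in s..t, f r * deriv g r :=
        intervalIntegral.integral_interval_sub_left (i1 _ _) (i1 _ _)
      have e2 : youngMap h k t - youngMap h k s = ∫ r in s..t, h r * deriv k r :=
        intervalIntegral.integral_interval_sub_left (i2 _ _) (i2 _ _)
      rw [sub_sub_sub_comm, e1, e2, ← intervalIntegral.integral_sub (i1 _ _) (i2 _ _),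
        ← intervalIntegral.integral_add
        (Continuous.intervalIntegrable (by fun_prop) _ _)
        (Continuous.intervalIntegrable (by fun_prop) _ _)]
      congr 1; ext r; ring
    rw [e]
    refine (abs_add_le _ _).trans ((add_le_add (B1 s t hs ht hst) (B2 s t hs ht hst)).trans ?_)
    rw [← add_mul, ← mul_add, mul_assoc K m]
    gcongr
    nlinarith
  rw [show 2 * K * m * (a + b) = 2 * (K * m * (a + b)) by ring]
  have hC : 0 ≤ K * m * (a + b) := by positivity
  refine hn_le γ _ _ hC (fun u hu => ?_) (fun u hu v hv huv => ?_)
  · rcases hu.1.eq_or_lt with h0 | h0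
    · rw [← h0]; simpa [youngMap] using hC
    · have := main 0 (by simp) u hu h0
      simp only [youngMap, intervalIntegral.integral_same, sub_zero] at this ⊢
      refine this.trans (mul_le_of_le_one_right hC (Real.rpow_le_one hu.1 hu.2 hγ.le))
  · rw [abs_of_pos (sub_pos.2 huv)]
    exact main u hu v hv huv
end

section
/- Let 0 < α, γ ≤ 1 with α + γ > 1, let f : [0,1] → ℝ be α-Hölder continuous and g : [0,1] → ℝ be γ-Hölder continuous, and fix t ∈ [0,1]. Then the left-endpoint Riemann sums Σ_{i=0}^{n−1} f(t_i)(g(t_{i+1}) − g(t_i)) over partitions π = {0 = t₀ < t₁ < ⋯ < t_n = t} of [0,t] converge as the mesh of π tends to zero: there exists I(t) ∈ ℝ such that for every η > 0 there is δ > 0 with |Σ_{i} f(t_i)(g(t_{i+1}) − g(t_i)) − I(t)| < η for every partition of [0,t] of mesh < δ. Moreover, if f and g are continuously differentiable then I(t) = ∫₀ᵗ f(r) g′(r) dr. (The limit I(t) defines the Young integral ∫₀ᵗ f d^y g.) -/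
open Set

/-- Left-endpoint Riemann sum of `f` against the increments of `g` along a partition
`pt : Fin (n+1) → ℝ`. -/
def riemannSum (f g : ℝ → ℝ) (n : ℕ) (pt : Fin (n + 1) → ℝ) : ℝ :=
  ∑ i : Fin n, f (pt i.castSucc) * (g (pt i.succ) - g (pt i.castSucc))

lemma young_exists_consec (X : ℝ → ℝ → ℝ) (F : Finset ℝ) :
    ∃ J : ℝ → ℝ, J 0 = 0 ∧ ∀ s ∈ F, ∀ u ∈ F, s < u → (∀ v ∈ F, ¬ (s < v ∧ v < u)) →
      J u - J s = X s u := by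
  suffices h : ∃ J : ℝ → ℝ, ∀ s ∈ F, ∀ u ∈ F, s < u → (∀ v ∈ F, ¬ (s < v ∧ v < u)) →
      J u - J s = X s u by
    obtain ⟨J, hJ⟩ := h
    refine ⟨fun x => J x - J 0, by simp, ?_⟩
    intro s hs u hu hsu hv
    rw [← hJ s hs u hu hsu hv]; ring
  induction F using Finset.induction_on_max with
  | empty => exact ⟨0, by simp⟩
  | insert b F hb ih =>
    obtain ⟨J, hJ⟩ := ih
    rcases F.eq_empty_or_nonempty with rfl | hne
    · refine ⟨0, ?_⟩
      intro s hs u hu hsu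
      simp at hs hu
      linarith
    · set m := F.max' hne with hm
      have hmF : m ∈ F := F.max'_mem hne
      refine ⟨fun x => if x = b then J m + X m b else J x, ?_⟩
      intro s hs u hu hsu hv
      have hsb : s ≠ b := by
        rintro rfl
        rcases Finset.mem_insert.1 hu with h | h
        · linarith
        · linarith [hb u h]
      have hsF : s ∈ F := (Finset.mem_insert.1 hs).resolve_left hsb
      rcases Finset.mem_insert.1 hu with h | h
      · subst h
        have hsm : s = m := by
          have h1 : s ≤ m := F.le_max' s hsF
          by_contra hne'
          exact hv m (Finset.mem_insert_of_mem hmF) ⟨lt_of_le_of_ne h1 hne', hb m hmF⟩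
        simp only [if_true, if_neg hsb]; rw [hsm]; ring
      · have hub : u ≠ b := (hb u h).ne
        simp only [if_neg hsb, if_neg hub]
        exact hJ s hsF u h hsu (fun v hvF => hv v (Finset.mem_insert_of_mem hvF))

lemma young_max_ineq (X : ℝ → ℝ → ℝ) (θ K C : ℝ) (hθ : 1 < θ) (hC0 : 0 ≤ C)
    (hC : 2 * (C * (1 / 2) ^ θ) + 2 * K ≤ C)
    (hX0 : ∀ s, X s s = 0)
    (hX : ∀ s v u, 0 ≤ s → s ≤ v → v ≤ u → u ≤ 1 →
      |X s u - X s v - X v u| ≤ K * (u - s) ^ θ) (hK : 0 ≤ K)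
    (F : Finset ℝ) (J : ℝ → ℝ)
    (hJ : ∀ s ∈ F, ∀ u ∈ F, s < u → (∀ v ∈ F, ¬ (s < v ∧ v < u)) → J u - J s = X s u) :
    ∀ n : ℕ, ∀ s ∈ F, ∀ u ∈ F, 0 ≤ s → s ≤ u → u ≤ 1 →
      (F.filter (fun v => s < v ∧ v < u)).card = n → |J u - J s - X s u| ≤ C * (u - s) ^ θ := by
  intro n
  induction n using Nat.strong_induction_on with
  | _ n ih =>
  intro s hs u hu h0 hsu h1 hn
  have hpos : 0 ≤ C * (u - s) ^ θ := mul_nonneg hC0 (Real.rpow_nonneg (by linarith) _)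
  rcases hsu.eq_or_lt with rfl | hlt
  · simpa [hX0] using hpos
  by_cases hem : ∀ v ∈ F, ¬ (s < v ∧ v < u)
  · rw [hJ s hs u hu hlt hem]; simpa using hpos
  push Not at hem
  obtain ⟨w, hwF, hsw, hwu⟩ := hem
  have hwm : w ∈ F.filter (fun v => s < v ∧ v < u) := by simp [hwF, hsw, hwu]
  let A := F.filter (fun v => s ≤ v ∧ v ≤ (s + u) / 2)
  let B := F.filter (fun v => (s + u) / 2 < v ∧ v ≤ u)
  have hsA : s ∈ A := by simp only [A, Finset.mem_filter]; exact ⟨hs, le_rfl, by linarith⟩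
  have huB : u ∈ B := by simp only [B, Finset.mem_filter]; exact ⟨hu, by linarith, le_rfl⟩
  obtain ⟨a, haA, ha⟩ : ∃ a ∈ A, ∀ x ∈ A, x ≤ a :=
    ⟨A.max' ⟨s, hsA⟩, A.max'_mem _, fun x hx => A.le_max' x hx⟩
  obtain ⟨b, hbB, hb⟩ : ∃ b ∈ B, ∀ x ∈ B, b ≤ x :=
    ⟨B.min' ⟨u, huB⟩, B.min'_mem _, fun x hx => B.min'_le x hx⟩
  simp only [A, B, Finset.mem_filter] at haA hbB ha hb
  obtain ⟨haF, hsa, ham⟩ := haA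
  obtain ⟨hbF, hmb, hbu⟩ := hbB
  have hab : J b - J a = X a b := by
    refine hJ a haF b hbF (by linarith) ?_
    rintro v hvF ⟨hav, hvb⟩
    rcases le_or_gt v ((s + u) / 2) with h | h
    · linarith [ha v ⟨hvF, by linarith, h⟩]
    · linarith [hb v ⟨hvF, h, by linarith⟩]
  have cardA : (F.filter (fun v => s < v ∧ v < a)).card < n := by
    rw [← hn]
    apply Finset.card_lt_card
    rw [Finset.ssubset_iff_of_subset]
    · rcases hsa.eq_or_lt with rfl | h
      · exact ⟨w, hwm, fun h => by have := (Finset.mem_filter.1 h).2; linarith [this.1, this.2]⟩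
      · exact ⟨a, by simp only [Finset.mem_filter]; exact ⟨haF, h, by linarith⟩, by simp⟩
    · intro v; simp only [Finset.mem_filter]
      rintro ⟨h1, h2, h3⟩; exact ⟨h1, h2, by linarith⟩
  have cardB : (F.filter (fun v => b < v ∧ v < u)).card < n := by
    rw [← hn]
    apply Finset.card_lt_card
    rw [Finset.ssubset_iff_of_subset]
    · rcases hbu.eq_or_lt with rfl | h
      · exact ⟨w, hwm, fun h => by have := (Finset.mem_filter.1 h).2; linarith [this.1, this.2]⟩
      · exact ⟨b, by simp only [Finset.mem_filter]; exact ⟨hbF, by linarith, h⟩, by simp⟩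
    · intro v; simp only [Finset.mem_filter]
      rintro ⟨h1, h2, h3⟩; exact ⟨h1, by linarith, h3⟩
  have i1 := ih _ cardA s hs a haF h0 hsa (by linarith) rfl
  have i2 := ih _ cardB b hbF u hu (by linarith) hbu h1 rfl
  have half : ∀ x, 0 ≤ x → x ≤ (u - s) / 2 → C * x ^ θ ≤ C * (1 / 2) ^ θ * (u - s) ^ θ := by
    intro x hx0 hx
    rw [mul_assoc, ← Real.mul_rpow (by norm_num) (by linarith)]
    apply mul_le_mul_of_nonneg_left _ hC0
    apply Real.rpow_le_rpow hx0 (by linarith) (by linarith)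
  have j1 := i1.trans (half _ (by linarith) (by linarith))
  have j2 := i2.trans (half _ (by linarith) (by linarith))
  have d1 := hX s a u h0 hsa (by linarith) h1
  have d2 := hX a b u (by linarith) (by linarith) hbu h1
  have d3 : K * (u - a) ^ θ ≤ K * (u - s) ^ θ :=
    mul_le_mul_of_nonneg_left
      (Real.rpow_le_rpow (by linarith) (by linarith) (by linarith)) hK
  have d4 := d2.trans d3
  have fin := mul_le_mul_of_nonneg_right hC (Real.rpow_nonneg (by linarith : 0 ≤ u - s) θ)
  rw [abs_le] at *
  constructor <;> nlinarith

lemma young_sewing (X : ℝ → ℝ → ℝ) (θ K : ℝ) (hθ : 1 < θ)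
    (hX0 : ∀ s, X s s = 0)
    (hX : ∀ s v u, 0 ≤ s → s ≤ v → v ≤ u → u ≤ 1 →
      |X s u - X s v - X v u| ≤ K * (u - s) ^ θ) (hK : 0 ≤ K) :
    ∃ (J : ℝ → ℝ) (C : ℝ), 0 ≤ C ∧ ∀ s u, 0 ≤ s → s ≤ u → u ≤ 1 →
      |J u - J s - X s u| ≤ C * (u - s) ^ θ := by
  have hr : (1 / 2 : ℝ) ^ θ < 1 / 2 := by
    have := Real.rpow_lt_rpow_of_exponent_gt (x := (1 / 2 : ℝ)) (by norm_num) (by norm_num) hθ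
    simpa using this
  set r := (1 / 2 : ℝ) ^ θ with hrdef
  set C := 2 * K / (1 - 2 * r) with hCdef
  have hC0 : 0 ≤ C := div_nonneg (by linarith) (by linarith)
  have hC : 2 * (C * r) + 2 * K ≤ C := by
    have : C * (1 - 2 * r) = 2 * K := div_mul_cancel₀ _ (by linarith)
    linarith
  choose JF hJF0 hJF using young_exists_consec X
  let U : Ultrafilter (Finset ℝ) := Ultrafilter.of Filter.atTop
  have hU : (U : Filter (Finset ℝ)) ≤ Filter.atTop := Ultrafilter.of_le _
  have hmem : ∀ x : ℝ, ∀ᶠ F in (U : Filter (Finset ℝ)), x ∈ F := by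
    intro x
    apply hU
    filter_upwards [Filter.eventually_ge_atTop ({x} : Finset ℝ)] with F hF
    exact hF (by simp)
  have key : ∀ s u, 0 ≤ s → s ≤ u → u ≤ 1 → ∀ᶠ F in (U : Filter (Finset ℝ)),
      |JF F u - JF F s - X s u| ≤ C * (u - s) ^ θ := by
    intro s u h0 hsu h1
    filter_upwards [hmem s, hmem u] with F hs hu
    exact young_max_ineq X θ K C hθ hC0 hC hX0 hX hK F (JF F) (hJF F) _ s hs u hu h0 hsu h1 rfl
  have hlim : ∀ x : ℝ, ∃ y, 0 ≤ x → x ≤ 1 →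
      Filter.Tendsto (fun F => JF F x) (U : Filter (Finset ℝ)) (nhds y) := by
    intro x
    by_cases hx : 0 ≤ x ∧ x ≤ 1
    · have hc : IsCompact (Set.Icc (X 0 x - C * (x - 0) ^ θ) (X 0 x + C * (x - 0) ^ θ)) :=
        isCompact_Icc
      obtain ⟨y, -, hy⟩ := hc.ultrafilter_le_nhds (U.map (fun F => JF F x)) (by
        rw [Filter.le_principal_iff]
        change ∀ᶠ F in (U : Filter (Finset ℝ)), JF F x ∈ _
        filter_upwards [key 0 x le_rfl hx.1 hx.2] with F hF
        rw [hJF0, abs_le] at hF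
        constructor <;> linarith [hF.1, hF.2])
      exact ⟨y, fun _ _ => hy⟩
    · exact ⟨0, fun h1 h2 => absurd ⟨h1, h2⟩ hx⟩
  choose J hJ using hlim
  refine ⟨J, C, hC0, ?_⟩
  intro s u h0 hsu h1
  have ts := hJ s h0 (by linarith)
  have tu := hJ u (by linarith) h1
  exact le_of_tendsto ((tu.sub ts).sub_const _).abs (key s u h0 hsu h1)

lemma young_telescope (J : ℝ → ℝ) : ∀ (n : ℕ) (pt : Fin (n + 1) → ℝ),
    ∑ i : Fin n, (J (pt i.succ) - J (pt i.castSucc)) = J (pt (Fin.last n)) - J (pt 0) := by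
  intro n
  induction n with
  | zero => intro pt; simp
  | succ n ih =>
    intro pt
    rw [Fin.sum_univ_castSucc]
    have := ih (fun i => pt i.castSucc)
    simp only [Fin.succ_castSucc] at this ⊢
    rw [this]; simp

lemma young_conv (f g J : ℝ → ℝ) (θ C : ℝ) (hθ : 1 < θ) (hC0 : 0 ≤ C)
    (hJ : ∀ s u, 0 ≤ s → s ≤ u → u ≤ 1 →
      |J u - J s - f s * (g u - g s)| ≤ C * (u - s) ^ θ)
    (t : ℝ) (ht : t ∈ Set.Icc (0:ℝ) 1) :
    ∀ η > 0, ∃ δ > 0, ∀ (n : ℕ) (pt : Fin (n + 1) → ℝ),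
        StrictMono pt → pt 0 = 0 → pt (Fin.last n) = t →
        (∀ i : Fin n, pt i.succ - pt i.castSucc < δ) →
        |riemannSum f g n pt - (J t - J 0)| < η := by
  intro η hη
  have hη' : 0 < η / (C + 1) := by positivity
  refine ⟨(η / (C + 1)) ^ (1 / (θ - 1)), Real.rpow_pos_of_pos hη' _, ?_⟩
  intro n pt hm hp0 hpt hmesh
  set δ := (η / (C + 1)) ^ (1 / (θ - 1)) with hδ
  have hδη : δ ^ (θ - 1) = η / (C + 1) := by
    rw [hδ, ← Real.rpow_mul hη'.le, one_div_mul_cancel (by linarith), Real.rpow_one]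
  have hrange : ∀ i, 0 ≤ pt i ∧ pt i ≤ 1 := by
    intro i
    constructor
    · rw [← hp0]; exact hm.monotone (Fin.zero_le i)
    · have := hm.monotone (Fin.le_last i)
      rw [hpt] at this; linarith [ht.2]
  have e : riemannSum f g n pt - (J t - J 0) = ∑ i : Fin n,
      (f (pt i.castSucc) * (g (pt i.succ) - g (pt i.castSucc))
        - (J (pt i.succ) - J (pt i.castSucc))) := by
    rw [Finset.sum_sub_distrib, young_telescope, hp0, hpt, riemannSum]
  have hterm : ∀ i : Fin n, |f (pt i.castSucc) * (g (pt i.succ) - g (pt i.castSucc))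
        - (J (pt i.succ) - J (pt i.castSucc))| ≤
        C * (η / (C + 1)) * (pt i.succ - pt i.castSucc) := by
    intro i
    have hlt : pt i.castSucc < pt i.succ := hm (Fin.castSucc_lt_succ)
    rw [abs_sub_comm]
    refine (hJ _ _ (hrange _).1 hlt.le (hrange _).2).trans ?_
    rw [mul_assoc]
    apply mul_le_mul_of_nonneg_left _ hC0
    have hh : 0 < pt i.succ - pt i.castSucc := by linarith
    have : (pt i.succ - pt i.castSucc) ^ θ
        = (pt i.succ - pt i.castSucc) ^ (θ - 1) * (pt i.succ - pt i.castSucc) := by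
      rw [← Real.rpow_add_one hh.ne']; congr 1; ring
    rw [this, ← hδη]
    apply mul_le_mul_of_nonneg_right _ hh.le
    exact Real.rpow_le_rpow hh.le (hmesh i).le (by linarith)
  rw [e]
  calc _ ≤ ∑ i : Fin n, C * (η / (C + 1)) * (pt i.succ - pt i.castSucc) :=
        (Finset.abs_sum_le_sum_abs _ _).trans (Finset.sum_le_sum fun i _ => hterm i)
    _ = C * (η / (C + 1)) * t := by
        rw [← Finset.mul_sum, young_telescope (fun x => x), hp0, hpt, sub_zero]
    _ ≤ C * (η / (C + 1)) * 1 := by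
        apply mul_le_mul_of_nonneg_left ht.2; positivity
    _ < η := by
        rw [mul_one, mul_div_assoc', div_lt_iff₀ (by linarith)]; nlinarith

lemma young_smooth (α γ : ℝ) (hα : 0 < α) (hγ1 : γ ≤ 1) (hαγ : 1 < α + γ) (f g : ℝ → ℝ)
    (K : ℝ) (hK : 0 ≤ K)
    (hf : ∀ s u, 0 ≤ s → s ≤ u → u ≤ 1 → |f u - f s| ≤ K * (u - s) ^ α)
    (cf : ContDiff ℝ 1 f) (cg : ContDiff ℝ 1 g) :
    ∃ C : ℝ, 0 ≤ C ∧ ∀ s u, 0 ≤ s → s ≤ u → u ≤ 1 →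
      |(∫ r in (0:ℝ)..u, f r * deriv g r) - (∫ r in (0:ℝ)..s, f r * deriv g r)
        - f s * (g u - g s)| ≤ C * (u - s) ^ (α + γ) := by
  have cg' : Continuous (deriv g) := cg.continuous_deriv (by norm_num)
  have cfc : Continuous f := cf.continuous
  obtain ⟨M, hM⟩ := (isCompact_Icc (a := (0:ℝ)) (b := 1)).exists_bound_of_continuousOn
    cg'.continuousOn
  have hM0 : 0 ≤ M := (norm_nonneg _).trans (hM 0 (by simp))
  refine ⟨K * M, by positivity, ?_⟩
  intro s u h0 hsu h1
  have ci : Continuous (fun r => f r * deriv g r) := cfc.mul cg'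
  rw [intervalIntegral.integral_interval_sub_left (ci.intervalIntegrable _ _)
    (ci.intervalIntegrable _ _)]
  have hgd : g u - g s = ∫ r in s..u, deriv g r := by
    rw [intervalIntegral.integral_deriv_eq_sub
      (fun x _ => (cg.differentiable (by norm_num)).differentiableAt)
      (cg'.intervalIntegrable _ _)]
  rw [hgd, ← intervalIntegral.integral_const_mul, ← intervalIntegral.integral_sub
    (ci.intervalIntegrable _ _) ((cg'.intervalIntegrable _ _).const_mul _),
    ← Real.norm_eq_abs]
  rcases hsu.eq_or_lt with rfl | hlt
  · simp only [intervalIntegral.integral_same, norm_zero]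
    rw [sub_self, Real.zero_rpow (by linarith)]; simp
  have hh : 0 < u - s := by linarith
  refine (intervalIntegral.norm_integral_le_of_norm_le_const
    (C := K * (u - s) ^ α * M) ?_).trans ?_
  · intro r hr
    rw [Set.uIoc_of_le hsu] at hr
    rw [← sub_mul, norm_mul]
    apply mul_le_mul _ (hM r ⟨by linarith [hr.1], by linarith [hr.2]⟩) (norm_nonneg _)
      (by positivity)
    refine (hf s r h0 hr.1.le (by linarith [hr.2])).trans ?_
    apply mul_le_mul_of_nonneg_left _ hK
    exact Real.rpow_le_rpow (by linarith [hr.1]) (by linarith [hr.2]) hα.le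
  · rw [abs_of_pos hh, Real.rpow_add hh]
    have : u - s ≤ (u - s) ^ γ := by
      have := Real.rpow_le_rpow_of_exponent_ge hh (by linarith) hγ1
      simpa using this
    have h2 : 0 ≤ K * (u - s) ^ α * M := by positivity
    nlinarith [mul_le_mul_of_nonneg_left this h2]

/-- Existence of the Young integral `∫₀ᵗ f d^y g` for `α`-Hölder `f` and `γ`-Hölder `g`
with `α + γ > 1`: the left-endpoint Riemann sums converge as the mesh tends to zero, and
if `f, g` are `C¹` the limit equals `∫₀ᵗ f(r) g'(r) dr`. -/
theorem young_integral_exists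
    (α γ : ℝ) (hα : 0 < α) (hα1 : α ≤ 1) (hγ : 0 < γ) (hγ1 : γ ≤ 1)
    (hαγ : 1 < α + γ)
    (f g : ℝ → ℝ)
    (hf : ∃ K : ℝ, ∀ s ∈ Set.Icc (0:ℝ) 1, ∀ u ∈ Set.Icc (0:ℝ) 1,
      |f u - f s| ≤ K * |u - s| ^ α)
    (hg : ∃ K : ℝ, ∀ s ∈ Set.Icc (0:ℝ) 1, ∀ u ∈ Set.Icc (0:ℝ) 1,
      |g u - g s| ≤ K * |u - s| ^ γ)
    (t : ℝ) (ht : t ∈ Set.Icc (0:ℝ) 1) :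
    ∃ I : ℝ,
      (∀ η > 0, ∃ δ > 0, ∀ (n : ℕ) (pt : Fin (n + 1) → ℝ),
        StrictMono pt → pt 0 = 0 → pt (Fin.last n) = t →
        (∀ i : Fin n, pt i.succ - pt i.castSucc < δ) →
        |riemannSum f g n pt - I| < η) ∧
      (ContDiff ℝ 1 f → ContDiff ℝ 1 g → I = ∫ r in (0:ℝ)..t, f r * deriv g r) := by
  have fix : ∀ (β : ℝ) (h : ℝ → ℝ), (∃ K : ℝ, ∀ s ∈ Set.Icc (0:ℝ) 1, ∀ u ∈ Set.Icc (0:ℝ) 1,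
      |h u - h s| ≤ K * |u - s| ^ β) → ∃ K : ℝ, 0 ≤ K ∧ ∀ s u, 0 ≤ s → s ≤ u → u ≤ 1 →
      |h u - h s| ≤ K * (u - s) ^ β := by
    rintro β h ⟨K, hK⟩
    refine ⟨|K|, abs_nonneg _, ?_⟩
    intro s u h0 hsu h1
    have := hK s ⟨h0, by linarith⟩ u ⟨by linarith, h1⟩
    rw [abs_of_nonneg (by linarith : 0 ≤ u - s)] at this
    exact this.trans (mul_le_mul_of_nonneg_right (le_abs_self K)
      (Real.rpow_nonneg (by linarith) _))
  obtain ⟨Kf, hKf, hf'⟩ := fix α f hf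
  obtain ⟨Kg, hKg, hg'⟩ := fix γ g hg
  by_cases hc : ContDiff ℝ 1 f ∧ ContDiff ℝ 1 g
  · obtain ⟨C, hC, hJ⟩ := young_smooth α γ hα hγ1 hαγ f g Kf hKf hf' hc.1 hc.2
    refine ⟨_, young_conv f g (fun x => ∫ r in (0:ℝ)..x, f r * deriv g r) (α + γ) C hαγ hC hJ t ht,
      fun _ _ => ?_⟩
    simp
  · obtain ⟨J, C, hC, hJ⟩ := young_sewing (fun s u => f s * (g u - g s)) (α + γ) (Kf * Kg) hαγ
      (by simp) (by
        intro s v u h0 hsv hvu h1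
        have e : f s * (g u - g s) - f s * (g v - g s) - f v * (g u - g v)
          = -((f v - f s) * (g u - g v)) := by ring
        simp only [e]
        rw [abs_neg, abs_mul]
        rcases (hsv.trans hvu).eq_or_lt with h | hlt
        · have h1 : v = s := by linarith
          subst h1
          simp only [sub_self, abs_zero, zero_mul]
          have : 0 ≤ u - v := by linarith
          positivity
        rw [Real.rpow_add (by linarith), mul_mul_mul_comm]
        have hus : 0 ≤ u - s := by linarith
        apply mul_le_mul _ _ (abs_nonneg _) (by positivity)
        · exact (hf' s v h0 hsv (by linarith)).trans (mul_le_mul_of_nonneg_left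
            (Real.rpow_le_rpow (by linarith) (by linarith) hα.le) hKf)
        · exact (hg' v u (by linarith) hvu h1).trans (mul_le_mul_of_nonneg_left
            (Real.rpow_le_rpow (by linarith) (by linarith) hγ.le) hKg)) (by positivity)
    exact ⟨J t - J 0, young_conv f g J (α + γ) C hαγ hC hJ t ht,
      fun h1 h2 => absurd ⟨h1, h2⟩ hc⟩
end

section
/- Let σ : ℝ → ℝ be continuous with linear growth (|σ(x)| ≤ K(1 + |x|) for some K > 0 and all x), whose zero set is exactly {x₀} (σ(x) = 0 iff x = x₀), and suppose there is ε > 0 such that ∫_{x₀}^{x₀+ε} dy/|σ(y)| = +∞ and ∫_{x₀−ε}^{x₀} dy/|σ(y)| = +∞. Then for every initial condition a ∈ ℝ the ordinary differential equation dX/dt = σ(X) admits exactly one solution on [0,1] with X(0) = a, i.e. there exists exactly one continuous X : [0,1] → ℝ with X(t) = a + ∫₀ᵗ σ(X(s)) ds for all t ∈ [0,1]. -/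
open MeasureTheory Set

namespace OdeAux

def Sol (σ : ℝ → ℝ) (a : ℝ) (Y : ℝ → ℝ) : Prop :=
  ContinuousOn Y (Set.Icc 0 1) ∧ ∀ t ∈ Set.Icc (0:ℝ) 1, Y t = a + ∫ s in (0:ℝ)..t, σ (Y s)

lemma Sol.neg {σ : ℝ → ℝ} {a : ℝ} {Y : ℝ → ℝ} (h : Sol σ a Y) :
    Sol (fun x => -σ (-x)) (-a) (fun t => -Y t) := by
  refine ⟨h.1.neg, fun t ht => ?_⟩
  have := h.2 t ht
  simp only [neg_neg, intervalIntegral.integral_neg]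
  linarith

lemma Sol.hasDerivAt {σ : ℝ → ℝ} (hσc : Continuous σ) {a : ℝ} {Y : ℝ → ℝ} (h : Sol σ a Y)
    {t : ℝ} (ht : t ∈ Ioo (0:ℝ) 1) : HasDerivAt Y (σ (Y t)) t := by
  have hc : ContinuousOn (fun s => σ (Y s)) (Icc 0 1) := hσc.comp_continuousOn h.1
  have hd : HasDerivAt (fun u => a + ∫ s in (0:ℝ)..u, σ (Y s)) (σ (Y t)) t := by
    refine HasDerivAt.const_add a ?_
    refine intervalIntegral.integral_hasDerivAt_right ?_ ?_ ?_
    · apply ContinuousOn.intervalIntegrable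
      rw [uIcc_of_le ht.1.le]
      exact hc.mono (Icc_subset_Icc_right ht.2.le)
    · exact (hc.mono Ioo_subset_Icc_self).stronglyMeasurableAtFilter isOpen_Ioo t ht
    · exact hc.continuousAt (Icc_mem_nhds ht.1 ht.2)
  refine hd.congr_of_eventuallyEq ?_
  filter_upwards [Icc_mem_nhds ht.1 ht.2] with u hu
  exact h.2 u hu

lemma F_deriv {σ : ℝ → ℝ} (hσc : Continuous σ) {x₀ : ℝ} (hnz : ∀ x, x₀ < x → σ x ≠ 0)
    {a x : ℝ} (ha : x₀ < a) (hx : x₀ < x) :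
    HasDerivAt (fun u => ∫ y in a..u, (σ y)⁻¹) (σ x)⁻¹ x := by
  have hc : ContinuousOn (fun y => (σ y)⁻¹) (Ioi x₀) :=
    hσc.continuousOn.inv₀ (fun y hy => hnz y hy)
  refine intervalIntegral.integral_hasDerivAt_right ?_ ?_ ?_
  · apply ContinuousOn.intervalIntegrable
    refine hc.mono fun y hy => ?_
    exact lt_of_lt_of_le (lt_min ha hx) hy.1
  · exact hc.stronglyMeasurableAtFilter isOpen_Ioi x hx
  · exact hc.continuousAt (Ioi_mem_nhds hx)

lemma F_slope {σ : ℝ → ℝ} (hσc : Continuous σ) {x₀ : ℝ} (hnz : ∀ x, x₀ < x → σ x ≠ 0)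
    {a x y : ℝ} (ha : x₀ < a) (hx : x₀ < x) (hxy : x < y) :
    ∃ ξ ∈ Ioo x y, y - x = σ ξ * ((∫ z in a..y, (σ z)⁻¹) - ∫ z in a..x, (σ z)⁻¹) := by
  obtain ⟨ξ, hξ, h⟩ := exists_hasDerivAt_eq_slope (fun u => ∫ y in a..u, (σ y)⁻¹)
    (fun x => (σ x)⁻¹) hxy
    (fun u hu => (F_deriv hσc hnz ha (hx.trans_le hu.1)).continuousAt.continuousWithinAt)
    (fun u hu => F_deriv hσc hnz ha (hx.trans hu.1))
  refine ⟨ξ, hξ, ?_⟩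
  have h1 := hnz ξ (hx.trans hξ.1)
  have h2 : y - x ≠ 0 := by linarith
  rw [eq_div_iff h2, inv_mul_eq_iff_eq_mul₀ h1] at h
  exact h

lemma F_inj {σ : ℝ → ℝ} (hσc : Continuous σ) {x₀ : ℝ} (hnz : ∀ x, x₀ < x → σ x ≠ 0)
    {a x y : ℝ} (ha : x₀ < a) (hx : x₀ < x) (hy : x₀ < y)
    (h : (∫ z in a..x, (σ z)⁻¹) = ∫ z in a..y, (σ z)⁻¹) : x = y := by
  rcases lt_trichotomy x y with hxy | hxy | hxy
  · obtain ⟨ξ, -, h1⟩ := F_slope hσc hnz ha hx hxy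
    rw [h] at h1; simp at h1; linarith
  · exact hxy
  · obtain ⟨ξ, -, h1⟩ := F_slope hσc hnz ha hy hxy
    rw [h] at h1; simp at h1; linarith

lemma F_time_le {σ : ℝ → ℝ} (hσc : Continuous σ) {x₀ : ℝ} (hnz : ∀ x, x₀ < x → σ x ≠ 0)
    {b : ℝ} {Y : ℝ → ℝ} (h : Sol σ b Y) {a : ℝ} (ha : x₀ < a) {u v : ℝ} (huv : u ≤ v)
    (hu : u ∈ Icc (0:ℝ) 1) (hv : v ∈ Icc (0:ℝ) 1) (hY : ∀ r ∈ Icc u v, x₀ < Y r) :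
    (∫ z in a..Y v, (σ z)⁻¹) - (∫ z in a..Y u, (σ z)⁻¹) = v - u := by
  have hsub : Icc u v ⊆ Icc 0 1 := Icc_subset_Icc hu.1 hv.2
  have := intervalIntegral.integral_eq_sub_of_hasDerivAt_of_le (f' := fun _ => (1:ℝ))
    (f := fun t => ∫ z in a..Y t, (σ z)⁻¹) huv ?_ ?_ (by simp)
  · simp at this; linarith
  · intro r hr
    exact (F_deriv hσc hnz ha (hY r hr)).continuousAt.comp_continuousWithinAt
      (h.1.mono hsub r hr)
  · intro r hr
    have hr' := hY r (Ioo_subset_Icc_self hr)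
    have := (F_deriv hσc hnz ha hr').comp r
      (h.hasDerivAt hσc ⟨hu.1.trans_lt hr.1, hr.2.trans_le hv.2⟩)
    rwa [inv_mul_cancel₀ (hnz _ hr')] at this

lemma F_time {σ : ℝ → ℝ} (hσc : Continuous σ) {x₀ : ℝ} (hnz : ∀ x, x₀ < x → σ x ≠ 0)
    {b : ℝ} {Y : ℝ → ℝ} (h : Sol σ b Y) {a : ℝ} (ha : x₀ < a) {u v : ℝ}
    (hu : u ∈ Icc (0:ℝ) 1) (hv : v ∈ Icc (0:ℝ) 1) (hY : ∀ r ∈ uIcc u v, x₀ < Y r) :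
    (∫ z in a..Y v, (σ z)⁻¹) - (∫ z in a..Y u, (σ z)⁻¹) = v - u := by
  rcases le_total u v with huv | huv
  · exact F_time_le hσc hnz h ha huv hu hv (by rwa [uIcc_of_le huv] at hY)
  · have := F_time_le hσc hnz h ha huv hv hu (by rwa [uIcc_of_ge huv] at hY)
    linarith

lemma sign {σ : ℝ → ℝ} (hσc : Continuous σ) {x₀ : ℝ} (hnz : ∀ x, x₀ < x → σ x ≠ 0) :
    (∀ x, x₀ < x → 0 < σ x) ∨ (∀ x, x₀ < x → σ x < 0) := by
  by_contra! hcon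
  obtain ⟨⟨x, hx, hx'⟩, ⟨y, hy, hy'⟩⟩ := hcon
  obtain ⟨z, hz, hz'⟩ := (isPreconnected_Ioi (a := x₀)).intermediate_value hx hy
    hσc.continuousOn ⟨hx', hy'⟩
  exact hnz z hz hz'

lemma abs_int {σ : ℝ → ℝ} (hσc : Continuous σ) {x₀ : ℝ} (hnz : ∀ x, x₀ < x → σ x ≠ 0)
    {c b : ℝ} (hc : x₀ < c) (hcb : c ≤ b) :
    ∫ y in c..b, ‖(σ y)⁻¹‖ = |∫ y in c..b, (σ y)⁻¹| := by
  rcases sign hσc hnz with hs | hs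
  · have : ∫ y in c..b, ‖(σ y)⁻¹‖ = ∫ y in c..b, (σ y)⁻¹ := by
      apply intervalIntegral.integral_congr
      intro y hy
      rw [uIcc_of_le hcb] at hy
      have := hs y (hc.trans_le hy.1)
      simp [abs_of_pos this]
    rw [← this, abs_of_nonneg]
    exact intervalIntegral.integral_nonneg hcb fun _ _ => norm_nonneg _
  · have : ∫ y in c..b, ‖(σ y)⁻¹‖ = -∫ y in c..b, (σ y)⁻¹ := by
      rw [← intervalIntegral.integral_neg]
      apply intervalIntegral.integral_congr
      intro y hy
      rw [uIcc_of_le hcb] at hy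
      have := hs y (hc.trans_le hy.1)
      simp [abs_of_neg this, inv_neg]
    rw [← abs_neg, ← this, abs_of_nonneg]
    exact intervalIntegral.integral_nonneg hcb fun _ _ => norm_nonneg _

lemma diverge {σ : ℝ → ℝ} (hσc : Continuous σ) {x₀ : ℝ} (hnz : ∀ x, x₀ < x → σ x ≠ 0)
    {ε : ℝ} (hright : ∫⁻ y in Set.Ioo x₀ (x₀ + ε), ENNReal.ofReal |σ y|⁻¹ = ⊤)
    {b : ℝ} (hb : x₀ < b) (M : ℝ) :
    ∃ c, x₀ < c ∧ c < b ∧ M < |∫ y in c..b, (σ y)⁻¹| := by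
  by_contra! hcon
  have hcont : ContinuousOn (fun y => (σ y)⁻¹) (Ioi x₀) :=
    hσc.continuousOn.inv₀ (fun y hy => hnz y hy)
  obtain ⟨u, -, hu, hut⟩ := exists_seq_strictAnti_tendsto' hb
  have h1 : IntegrableOn (fun y => (σ y)⁻¹) (Ioc x₀ b) := by
    refine integrableOn_Ioc_of_intervalIntegral_norm_bounded_left (I := M) (l := Filter.atTop)
      (a := u) (fun i => ?_) hut (Filter.Eventually.of_forall fun i => ?_)
    · refine (ContinuousOn.integrableOn_Icc (hcont.mono ?_)).mono_set Ioc_subset_Icc_self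
      intro y hy
      exact (hu i).1.trans_le hy.1
    · have := abs_int hσc hnz (hu i).1 (hu i).2.le
      rw [intervalIntegral.integral_of_le (hu i).2.le] at this
      rw [this]
      exact hcon _ (hu i).1 (hu i).2
  have h2 : IntegrableOn (fun y => (σ y)⁻¹) (Icc b (x₀ + ε)) :=
    ContinuousOn.integrableOn_Icc (hcont.mono fun y hy => hb.trans_le hy.1)
  have h3 : IntegrableOn (fun y => (σ y)⁻¹) (Ioo x₀ (x₀ + ε)) := by
    refine (h1.union h2).mono_set fun y hy => ?_
    rcases le_total y b with h | h
    · exact Or.inl ⟨hy.1, h⟩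
    · exact Or.inr ⟨h, hy.2.le⟩
  have h4 := h3.hasFiniteIntegral
  rw [hasFiniteIntegral_iff_norm] at h4
  simp only [norm_inv, Real.norm_eq_abs] at h4
  exact h4.ne hright

lemma stay {σ : ℝ → ℝ} (hσc : Continuous σ) {x₀ : ℝ} (hnz : ∀ x, x₀ < x → σ x ≠ 0)
    {ε : ℝ} (hright : ∫⁻ y in Set.Ioo x₀ (x₀ + ε), ENNReal.ofReal |σ y|⁻¹ = ⊤)
    {a : ℝ} {Y : ℝ → ℝ} (h : Sol σ a Y) {s t : ℝ} (hs : s ∈ Icc (0:ℝ) 1)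
    (ht : t ∈ Icc (0:ℝ) 1) (hYs : x₀ < Y s) : x₀ < Y t := by
  by_contra! hYt
  obtain ⟨c, hc, hcs, hM⟩ := diverge hσc hnz hright hYs 1
  have hsub : ∀ r ∈ Icc (0:ℝ) 1, uIcc s r ⊆ Icc 0 1 := fun r hr => uIcc_subset_Icc hs hr
  have ivt : ∀ r ∈ Icc (0:ℝ) 1, Y r ≤ c → ∃ q ∈ uIcc s r, Y q = c := by
    intro r hr hle
    have := intermediate_value_uIcc (h.1.mono (hsub r hr))
    exact this (mem_uIcc.2 (Or.inr ⟨hle, hcs.le⟩))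
  have hcomp : IsCompact (Icc (0:ℝ) 1 ∩ Y ⁻¹' {c}) :=
    isCompact_Icc.of_isClosed_subset
      (h.1.preimage_isClosed_of_isClosed isClosed_Icc isClosed_singleton) inter_subset_left
  obtain ⟨q, hq, hq'⟩ := ivt t ht (hYt.trans hc.le)
  obtain ⟨r, hr, hmin⟩ := hcomp.exists_isMinOn (f := fun r => |r - s|) ⟨q, hsub t ht hq, hq'⟩
    (by fun_prop)
  have hrc : Y r = c := hr.2
  have hge : ∀ p ∈ uIcc s r, c ≤ Y p := by
    intro p hp
    by_contra! hlt
    have hp1 := hsub r hr.1 hp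
    obtain ⟨q, hq, hq'⟩ := ivt p hp1 hlt.le
    have h1 : |r - s| ≤ |q - s| := hmin ⟨hsub p hp1 hq, hq'⟩
    have h2 := abs_sub_left_of_mem_uIcc hq
    have h3 : p = r := by
      rw [mem_uIcc] at hp hq
      rcases hp with hp | hp <;> rcases hq with hq | hq <;>
      · rcases le_total r s with h4 | h4 <;> rcases le_total q s with h5 | h5 <;>
        simp only [abs_of_nonneg, abs_of_nonpos, sub_nonneg, sub_nonpos, h4, h5] at h1 <;>
        linarith
    rw [h3, hrc] at hlt
    exact lt_irrefl _ hlt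
  have := F_time hσc hnz h hc (u := r) (v := s) hr.1 hs
    (fun p hp => hc.trans_le (hge p (by rwa [uIcc_comm])))
  rw [hrc, intervalIntegral.integral_same, sub_zero] at this
  rw [this] at hM
  have h5 := abs_le.2 ⟨by linarith [hs.1, hr.1.2], (by linarith [hs.2, hr.1.1] : s - r ≤ 1)⟩
  linarith

lemma reach {σ : ℝ → ℝ} (hσc : Continuous σ) {K : ℝ} (hK : 0 < K)
    (hgrowth : ∀ x : ℝ, |σ x| ≤ K * (1 + |x|)) {x₀ : ℝ} (hnz : ∀ x, x₀ < x → σ x ≠ 0)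
    {ε : ℝ} (hright : ∫⁻ y in Set.Ioo x₀ (x₀ + ε), ENNReal.ofReal |σ y|⁻¹ = ⊤)
    {a : ℝ} (ha : x₀ < a) : ∃ b, x₀ < b ∧ 1 ≤ ∫ y in a..b, (σ y)⁻¹ := by
  have hcont : ContinuousOn (fun y => (σ y)⁻¹) (Ioi x₀) :=
    hσc.continuousOn.inv₀ (fun y hy => hnz y hy)
  have hint : ∀ u v, x₀ < u → x₀ < v → IntervalIntegrable (fun y => (σ y)⁻¹) volume u v := by
    intro u v hu hv
    apply ContinuousOn.intervalIntegrable
    exact hcont.mono fun y hy => lt_of_lt_of_le (lt_min hu hv) hy.1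
  rcases sign hσc hnz with hs | hs
  · set a' := max a 1
    have ha1 : a ≤ a' := le_max_left _ _
    have h1 : 1 ≤ a' := le_max_right _ _
    have he : 1 ≤ Real.exp (2 * K) := Real.one_le_exp (by positivity)
    have hab : a' ≤ a' * Real.exp (2 * K) := le_mul_of_one_le_right (by linarith) he
    refine ⟨a' * Real.exp (2 * K), by linarith, ?_⟩
    rw [← intervalIntegral.integral_add_adjacent_intervals
      (hint a a' ha (by linarith)) (hint a' _ (by linarith) (by linarith))]
    have e1 : 0 ≤ ∫ y in a..a', (σ y)⁻¹ :=
      intervalIntegral.integral_nonneg ha1 fun y hy => (inv_pos.2 (hs y (ha.trans_le hy.1))).le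
    have e2 : ∫ y in a'..(a' * Real.exp (2 * K)), (2 * K)⁻¹ * y⁻¹ ≤
        ∫ y in a'..(a' * Real.exp (2 * K)), (σ y)⁻¹ := by
      refine intervalIntegral.integral_mono_on hab ?_ (hint _ _ (by linarith) (by linarith)) ?_
      · apply ContinuousOn.intervalIntegrable
        rw [uIcc_of_le hab]
        refine continuousOn_const.mul (continuousOn_id.inv₀ fun y hy => ?_)
        have := hy.1
        simp only [id]; linarith
      · intro y hy
        have hy1 : 1 ≤ y := h1.trans hy.1
        have hp := hs y (by linarith [hy.1])
        rw [← mul_inv]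
        apply inv_anti₀ hp
        have := hgrowth y
        rw [abs_of_pos hp, abs_of_pos (by linarith : 0 < y)] at this
        nlinarith
    have e3 : ∫ y in a'..(a' * Real.exp (2 * K)), (2 * K)⁻¹ * y⁻¹ = 1 := by
      rw [intervalIntegral.integral_const_mul, integral_inv_of_pos (by linarith) (by linarith),
        mul_div_cancel_left₀ _ (by linarith : a' ≠ 0), Real.log_exp]
      field_simp
    linarith
  · obtain ⟨c, hc, hca, hM⟩ := diverge hσc hnz hright ha 1
    refine ⟨c, hc, ?_⟩
    have : ∫ y in c..a, (σ y)⁻¹ ≤ 0 := by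
      have : 0 ≤ ∫ y in c..a, -(σ y)⁻¹ := intervalIntegral.integral_nonneg hca.le
        fun y hy => by
          have := inv_lt_zero.2 (hs y (hc.trans_le hy.1)); linarith
      rw [intervalIntegral.integral_neg] at this
      linarith
    rw [abs_of_nonpos this] at hM
    rw [intervalIntegral.integral_symm]
    exact hM.le

lemma main_right {σ : ℝ → ℝ} (hσc : Continuous σ) {K : ℝ} (hK : 0 < K)
    (hgrowth : ∀ x : ℝ, |σ x| ≤ K * (1 + |x|)) {x₀ : ℝ} (hnz : ∀ x, x₀ < x → σ x ≠ 0)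
    {ε : ℝ} (hright : ∫⁻ y in Set.Ioo x₀ (x₀ + ε), ENNReal.ofReal |σ y|⁻¹ = ⊤)
    {a : ℝ} (ha : x₀ < a) :
    ∃ X, Sol σ a X ∧ ∀ Y, Sol σ a Y → ∀ t ∈ Icc (0:ℝ) 1, Y t = X t := by
  obtain ⟨b, hb, hFb⟩ := reach hσc hK hgrowth hnz hright ha
  have hJ : ∀ x ∈ uIcc a b, x₀ < x := fun x hx => (lt_min ha hb).trans_le hx.1
  have hex : ∀ t ∈ Icc (0:ℝ) 1, ∃ x ∈ uIcc a b, (∫ y in a..x, (σ y)⁻¹) = t := by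
    intro t ht
    have := intermediate_value_uIcc (a := a) (b := b) (f := fun u => ∫ y in a..u, (σ y)⁻¹)
      (fun x hx => (F_deriv hσc hnz ha (hJ x hx)).continuousAt.continuousWithinAt)
    refine this (mem_uIcc.2 (Or.inl ⟨?_, ht.2.trans hFb⟩))
    simpa using ht.1
  choose! X hX hFX using hex
  obtain ⟨C, hC⟩ := (isCompact_uIcc (a := a) (b := b)).exists_bound_of_continuousOn
    hσc.continuousOn
  have key : ∀ s ∈ Icc (0:ℝ) 1, ∀ t ∈ Icc (0:ℝ) 1, X s < X t → |X s - X t| ≤ C * |s - t| := by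
    intro s hs t ht hlt
    obtain ⟨ξ, hξ, h⟩ := F_slope hσc hnz ha (hJ _ (hX s hs)) hlt
    rw [hFX s hs, hFX t ht] at h
    have := hC ξ ((convex_uIcc a b).ordConnected.out (hX s hs) (hX t ht) ⟨hξ.1.le, hξ.2.le⟩)
    rw [abs_sub_comm, h, abs_mul, abs_sub_comm t s]
    exact mul_le_mul_of_nonneg_right this (abs_nonneg _)
  have hC0 : 0 ≤ C := (norm_nonneg _).trans (hC a left_mem_uIcc)
  have hXc : ContinuousOn X (Icc 0 1) := by
    refine (LipschitzOnWith.of_dist_le_mul (K := ⟨C, hC0⟩) fun s hs t ht => ?_).continuousOn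
    rw [Real.dist_eq, Real.dist_eq]
    change _ ≤ C * _
    rcases lt_trichotomy (X s) (X t) with h | h | h
    · exact key s hs t ht h
    · rw [h]; simp; positivity
    · rw [abs_sub_comm, abs_sub_comm s t]; exact key t ht s hs h
  have hX0 : X 0 = a := by
    have h0 : (0:ℝ) ∈ Icc (0:ℝ) 1 := by simp
    refine F_inj hσc hnz ha (hJ _ (hX 0 h0)) ha ?_
    rw [hFX 0 h0]; simp
  have hXd : ∀ t ∈ Ioo (0:ℝ) 1, HasDerivAt X (σ (X t)) t := by
    intro t ht
    have hx := hJ _ (hX t (Ioo_subset_Icc_self ht))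
    have := HasDerivAt.of_local_left_inverse (hXc.continuousAt (Icc_mem_nhds ht.1 ht.2))
      (F_deriv hσc hnz ha hx) (inv_ne_zero (hnz _ hx))
      (by filter_upwards [Icc_mem_nhds ht.1 ht.2] with u hu using hFX u hu)
    rwa [inv_inv] at this
  refine ⟨X, ⟨hXc, fun t ht => ?_⟩, fun Y hY t ht => ?_⟩
  · have hsub : Icc 0 t ⊆ Icc (0:ℝ) 1 := Icc_subset_Icc_right ht.2
    rw [intervalIntegral.integral_eq_sub_of_hasDerivAt_of_le ht.1 (hXc.mono hsub)
      (fun u hu => hXd u ⟨hu.1, hu.2.trans_le ht.2⟩), hX0]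
    · ring
    · apply ContinuousOn.intervalIntegrable
      rw [uIcc_of_le ht.1]
      exact hσc.comp_continuousOn (hXc.mono hsub)
  · have h0 : (0:ℝ) ∈ Icc (0:ℝ) 1 := by simp
    have hY0 : Y 0 = a := by simpa using hY.2 0 h0
    have hst : ∀ r ∈ Icc (0:ℝ) 1, x₀ < Y r := fun r hr =>
      stay hσc hnz hright hY h0 hr (by rwa [hY0])
    have := F_time hσc hnz hY ha h0 ht (fun r hr => hst r (uIcc_subset_Icc h0 ht hr))
    rw [hY0, intervalIntegral.integral_same] at this
    refine F_inj hσc hnz ha (hst t ht) (hJ _ (hX t ht)) ?_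
    rw [hFX t ht]; linarith

lemma flip {σ : ℝ → ℝ} {x₀ ε : ℝ}
    (hleft : ∫⁻ y in Set.Ioo (x₀ - ε) x₀, ENNReal.ofReal |σ y|⁻¹ = ⊤) :
    ∫⁻ y in Set.Ioo (-x₀) (-x₀ + ε), ENNReal.ofReal |-σ (-y)|⁻¹ = ⊤ := by
  rw [← hleft]
  have := (Measure.measurePreserving_neg (volume : Measure ℝ)).setLIntegral_comp_preimage_emb
    (MeasurableEquiv.neg ℝ).measurableEmbedding (fun y => ENNReal.ofReal |σ y|⁻¹)
    (Ioo (x₀ - ε) x₀)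
  rw [← this]
  have hset : Neg.neg ⁻¹' Ioo (x₀ - ε) x₀ = Ioo (-x₀) (-x₀ + ε) := by
    ext y; simp only [mem_preimage, mem_Ioo]; constructor <;> rintro ⟨h1, h2⟩ <;>
      constructor <;> linarith
  rw [hset]
  simp only [abs_neg]

end OdeAux

open OdeAux in
/-- Uniqueness for `dX/dt = σ(X)` for every initial condition, when `σ` is continuous with
linear growth, vanishes exactly at `x₀`, and `1/|σ|` is non-integrable on both sides of
`x₀`. -/
theorem ode_existence_uniqueness
    (σ : ℝ → ℝ) (hσc : Continuous σ)
    (K : ℝ) (hK : 0 < K) (hgrowth : ∀ x : ℝ, |σ x| ≤ K * (1 + |x|))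
    (x₀ : ℝ) (hzero : ∀ x : ℝ, σ x = 0 ↔ x = x₀)
    (ε : ℝ) (hε : 0 < ε)
    (hright : ∫⁻ y in Set.Ioo x₀ (x₀ + ε), ENNReal.ofReal |σ y|⁻¹ = ⊤)
    (hleft : ∫⁻ y in Set.Ioo (x₀ - ε) x₀, ENNReal.ofReal |σ y|⁻¹ = ⊤) :
    ∀ a : ℝ,
      ∃ X : ℝ → ℝ,
        (ContinuousOn X (Set.Icc 0 1) ∧
          ∀ t ∈ Set.Icc (0:ℝ) 1, X t = a + ∫ s in (0:ℝ)..t, σ (X s)) ∧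
        ∀ Y : ℝ → ℝ,
          (ContinuousOn Y (Set.Icc 0 1) ∧
            ∀ t ∈ Set.Icc (0:ℝ) 1, Y t = a + ∫ s in (0:ℝ)..t, σ (Y s)) →
          ∀ t ∈ Set.Icc (0:ℝ) 1, Y t = X t := by
  intro a
  change ∃ X, Sol σ a X ∧ ∀ Y, Sol σ a Y → ∀ t ∈ Icc (0:ℝ) 1, Y t = X t
  have hnz : ∀ x, x₀ < x → σ x ≠ 0 := fun x hx h => hx.ne' ((hzero x).1 h)
  have hnz' : ∀ x, -x₀ < x → -σ (-x) ≠ 0 := fun x hx h => by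
    have := (hzero (-x)).1 (neg_eq_zero.1 h)
    linarith
  have hc' : Continuous (fun x => -σ (-x)) := by fun_prop
  have hl' := flip hleft
  rcases lt_trichotomy x₀ a with ha | ha | ha
  · exact main_right hσc hK hgrowth hnz hright ha
  · subst ha
    refine ⟨fun _ => x₀, ⟨continuousOn_const, fun t _ => by simp [(hzero x₀).2 rfl]⟩,
      fun Y hY t ht => ?_⟩
    have h0 : (0:ℝ) ∈ Icc (0:ℝ) 1 := by simp
    have hY0 : Y 0 = x₀ := by simpa using hY.2 0 h0
    rcases lt_trichotomy (Y t) x₀ with h | h | h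
    · have := stay hc' hnz' hl' hY.neg ht h0 (by simpa using h)
      simp [hY0] at this
    · exact h
    · have := stay hσc hnz hright hY ht h0 h
      simp [hY0] at this
  · obtain ⟨X, hX, hu⟩ := main_right hc' hK (fun x => by simpa using hgrowth (-x)) hnz' hl'
      (neg_lt_neg ha)
    refine ⟨fun t => -X t, by simpa using hX.neg, fun Y hY t ht => ?_⟩
    have := hu _ hY.neg t ht
    linarith
end
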